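/- arXiv:1608.05969 — 11 statements merged into one kernel-verified Lean document; each statement's English description precedes it below -/
import Mathlib

section
/- Let H be a real Hilbert space, C ⊆ H a nonempty convex compact subset, T : C → C an L-Lipschitzian pseudo-contraction for some L > 0, and (αₙ), (βₙ) sequences in [0,1] such that lim βₙ = 0, ∑ₙ αₙβₙ = ∞, and αₙ ≤ βₙ for all n. Then for every x ∈ C the Ishikawa iteration (xₙ) starting at x converges strongly (in norm) to a fixed point of T. -/
theorem norm_sq_convex_combination {H : Type*} [NormedAddCommGroup H] [InnerProductSpace ℝ H]
    (a : ℝ) (u v : H) :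
    ‖a • u + (1 - a) • v‖ ^ 2 =
      a * ‖u‖ ^ 2 + (1 - a) * ‖v‖ ^ 2 - a * (1 - a) * ‖u - v‖ ^ 2 := by
  rw [norm_add_sq_real, norm_sub_sq_real, norm_smul, norm_smul, mul_pow, mul_pow,
    Real.norm_eq_abs, Real.norm_eq_abs, sq_abs, sq_abs, inner_smul_left, inner_smul_right]
  simp only [conj_trivial]
  ring

theorem norm_sq_convex_combination_sub {H : Type*} [NormedAddCommGroup H]
    [InnerProductSpace ℝ H] (a : ℝ) (u v p : H) :
    ‖a • u + (1 - a) • v - p‖ ^ 2 =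
      a * ‖u - p‖ ^ 2 + (1 - a) * ‖v - p‖ ^ 2 - a * (1 - a) * ‖u - v‖ ^ 2 := by
  have h : a • u + (1 - a) • v - p = a • (u - p) + (1 - a) • (v - p) := by module
  rw [h, norm_sq_convex_combination, sub_sub_sub_cancel_right]

/-- A map strictly decreasing nonzero displacements has a fixed point on a compact set. -/
theorem IsCompact.exists_fixedPoint_of_norm_sub_lt {E : Type*} [NormedAddCommGroup E]
    {C : Set E} (hC : IsCompact C) (hne : C.Nonempty) {g : E → E} (hg : Set.MapsTo g C C)
    (hcont : ContinuousOn g C)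
    (hlt : ∀ c ∈ C, ∀ d ∈ C, c ≠ d → ‖g c - g d‖ < ‖c - d‖) :
    ∃ z ∈ C, g z = z := by
  obtain ⟨z, hz, hmin⟩ := hC.exists_isMinOn hne (hcont.sub continuousOn_id).norm
  refine ⟨z, hz, by_contra fun h => ?_⟩
  exact absurd (hmin (hg hz)) (not_le.2 (hlt _ (hg hz) _ hz h))

theorem exists_sub_eq_smul_of_pseudocontraction
    {H : Type*} [NormedAddCommGroup H] [InnerProductSpace ℝ H]
    {C : Set H} (hCconv : Convex ℝ C) (hCcomp : IsCompact C)
    {T : H → H} (hTmap : ∀ c ∈ C, T c ∈ C) (hT : ContinuousOn T C) {L : ℝ}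
    (hLip : ∀ c ∈ C, ∀ d ∈ C, ‖T c - T d‖ ≤ L * ‖c - d‖)
    (hPC : ∀ c ∈ C, ∀ d ∈ C,
      ‖T c - T d‖ ^ 2 ≤ ‖c - d‖ ^ 2 + ‖(c - T c) - (d - T d)‖ ^ 2)
    {u : H} (hu : u ∈ C) {t : ℝ} (ht0 : 0 < t) (ht1 : t ≤ 1) :
    ∃ z ∈ C, z - T z = t • (u - T z) := by
  obtain ⟨s, hs0, hs1, hs⟩ : ∃ s : ℝ, 0 < s ∧ s ≤ 1 ∧ s * (L ^ 2 + 1) = t := by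
    refine ⟨t / (L ^ 2 + 1), by positivity, ?_, by field_simp⟩
    rw [div_le_one (by positivity)]
    nlinarith [sq_nonneg L]
  obtain ⟨z, hz, hgz⟩ := hCcomp.exists_fixedPoint_of_norm_sub_lt ⟨u, hu⟩
    (g := fun z => s • (t • u + (1 - t) • T z) + (1 - s) • z)
    (fun z hz => hCconv (hCconv hu (hTmap z hz) ht0.le (by linarith) (by ring)) hz hs0.le
      (by linarith) (by ring)) (by fun_prop) (by
      intro c hc d hd hcd
      have hpos : 0 < ‖c - d‖ := norm_pos_iff.2 (sub_ne_zero.2 hcd)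
      refine lt_of_pow_lt_pow_left₀ 2 hpos.le ?_
      have h1 : s • (t • u + (1 - t) • T c) + (1 - s) • c
          - (s • (t • u + (1 - t) • T d) + (1 - s) • d)
          = (s * (1 - t)) • (T c - T d) + (1 - s) • (c - d) := by module
      have h2 : (c - T c) - (d - T d) = (c - d) - (T c - T d) := by abel
      have h3 := hPC c hc d hd
      have h4 : ‖T c - T d‖ ^ 2 ≤ L ^ 2 * ‖c - d‖ ^ 2 := by
        rw [← mul_pow]
        exact pow_le_pow_left₀ (norm_nonneg _) (hLip c hc d hd) 2
      rw [h2, norm_sub_sq_real (c - d), real_inner_comm] at h3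
      rw [h1, norm_add_sq_real, norm_smul, norm_smul, mul_pow, mul_pow, Real.norm_eq_abs,
        Real.norm_eq_abs, sq_abs, sq_abs, real_inner_smul_left, real_inner_smul_right]
      generalize inner ℝ (T c - T d) (c - d) = i at *
      generalize ‖T c - T d‖ ^ 2 = D at *
      have hE : 0 < ‖c - d‖ ^ 2 := by positivity
      generalize ‖c - d‖ ^ 2 = E at *
      have h5 : (s * (1 - t)) * ((1 - s) * i) ≤ (s * (1 - t)) * ((1 - s) * E) := by
        have : i ≤ E := by linarith
        have := sub_nonneg.2 ht1
        have := sub_nonneg.2 hs1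
        gcongr
      have h6 : (s * (1 - t)) ^ 2 * D ≤ s ^ 2 * (L ^ 2 * E) := by
        have h7 : (s * (1 - t)) ^ 2 ≤ s ^ 2 := by
          apply pow_le_pow_left₀ (mul_nonneg hs0.le (by linarith))
          nlinarith
        calc (s * (1 - t)) ^ 2 * D ≤ (s * (1 - t)) ^ 2 * (L ^ 2 * E) := by gcongr
          _ ≤ _ := by gcongr
      have h8 : 0 < s * t * E := by positivity
      have h9 : 0 ≤ s ^ 2 * (1 - t) * E :=
        mul_nonneg (mul_nonneg (sq_nonneg _) (by linarith)) hE.le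
      have h10 : s ^ 2 * (L ^ 2 * E) = s * t * E - s ^ 2 * E := by rw [← hs]; ring
      nlinarith)
  refine ⟨z, hz, smul_right_injective H hs0.ne' ?_⟩
  have h : s • (t • u + (1 - t) • T z) + (1 - s) • z - z = 0 := sub_eq_zero.2 hgz
  rw [← sub_eq_zero, ← neg_eq_zero, ← h]
  module

/-- A Lipschitzian pseudo-contraction of a nonempty compact convex set has a fixed point. -/
theorem exists_fixedPoint_of_pseudocontraction
    {H : Type*} [NormedAddCommGroup H] [InnerProductSpace ℝ H]
    {C : Set H} (hCne : C.Nonempty) (hCconv : Convex ℝ C) (hCcomp : IsCompact C)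
    {T : H → H} (hTmap : ∀ c ∈ C, T c ∈ C) (hT : ContinuousOn T C) {L : ℝ}
    (hLip : ∀ c ∈ C, ∀ d ∈ C, ‖T c - T d‖ ≤ L * ‖c - d‖)
    (hPC : ∀ c ∈ C, ∀ d ∈ C,
      ‖T c - T d‖ ^ 2 ≤ ‖c - d‖ ^ 2 + ‖(c - T c) - (d - T d)‖ ^ 2) :
    ∃ p ∈ C, T p = p := by
  obtain ⟨p, hp, hmin⟩ := hCcomp.exists_isMinOn hCne (continuousOn_id.sub hT).norm
  obtain ⟨u, hu⟩ := hCne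
  obtain ⟨M, hM⟩ := hCcomp.isBounded.exists_norm_le
  refine ⟨p, hp, by_contra fun h => ?_⟩
  have hpos : 0 < ‖p - T p‖ := norm_pos_iff.2 (sub_ne_zero.2 (Ne.symm h))
  have hM0 : 0 ≤ M := (norm_nonneg u).trans (hM u hu)
  set t : ℝ := min 1 (‖p - T p‖ / (2 * M + 1) / 2) with ht
  have ht0 : 0 < t := by positivity
  obtain ⟨z, hz, hzt⟩ := exists_sub_eq_smul_of_pseudocontraction hCconv hCcomp hTmap hT hLip hPC
    hu ht0 (min_le_left _ _)
  have h1 : ‖p - T p‖ ≤ ‖z - T z‖ := hmin hz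
  have h2 : ‖u - T z‖ ≤ 2 * M + 1 := by
    linarith [norm_sub_le u (T z), hM u hu, hM _ (hTmap z hz)]
  rw [hzt, norm_smul, Real.norm_of_nonneg ht0.le] at h1
  have h3 : t * ‖u - T z‖ ≤ ‖p - T p‖ / (2 * M + 1) / 2 * (2 * M + 1) := by
    gcongr
    exact min_le_right _ _
  have h4 : ‖p - T p‖ / (2 * M + 1) / 2 * (2 * M + 1) = ‖p - T p‖ / 2 := by field_simp
  linarith

/-- The basic estimate for one step of the Ishikawa iteration. -/
theorem ishikawa_step_norm_sq_le
    {H : Type*} [NormedAddCommGroup H] [InnerProductSpace ℝ H]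
    {C : Set H} (hCconv : Convex ℝ C) {T : H → H} (hTmap : ∀ c ∈ C, T c ∈ C) {L : ℝ}
    (hLip : ∀ c ∈ C, ∀ d ∈ C, ‖T c - T d‖ ≤ L * ‖c - d‖)
    (hPC : ∀ c ∈ C, ∀ d ∈ C,
      ‖T c - T d‖ ^ 2 ≤ ‖c - d‖ ^ 2 + ‖(c - T c) - (d - T d)‖ ^ 2)
    {a b : ℝ} (ha : 0 ≤ a) (hab : a ≤ b) (hb : b ≤ 1)
    {p x y : H} (hp : p ∈ C) (hTp : T p = p) (hx : x ∈ C)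
    (hy : y = b • T x + (1 - b) • x) :
    ‖a • T y + (1 - a) • x - p‖ ^ 2 ≤
      ‖x - p‖ ^ 2 - a * b * (1 - 2 * b - L ^ 2 * b ^ 2) * ‖x - T x‖ ^ 2 := by
  have hb0 : 0 ≤ b := ha.trans hab
  have hyC : y ∈ C := hy ▸ hCconv (hTmap x hx) hx hb0 (by linarith) (by ring)
  have h1 := hPC y hyC p hp
  have h2 := hPC x hx p hp
  rw [hTp, sub_self, sub_zero] at h1 h2
  have h3 : ‖T x - T y‖ ^ 2 ≤ L ^ 2 * b ^ 2 * ‖x - T x‖ ^ 2 := by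
    have : x - y = b • (x - T x) := by rw [hy]; module
    have h := pow_le_pow_left₀ (norm_nonneg _) (hLip x hx y hyC) 2
    rw [this, norm_smul, Real.norm_of_nonneg hb0] at h
    linarith
  have h4 := norm_sq_convex_combination_sub a (T y) x p
  have h5 := norm_sq_convex_combination_sub b (T x) x p
  have h6 := norm_sq_convex_combination_sub b (T x) x (T y)
  rw [← hy, norm_sub_rev (T x) x] at h5 h6
  rw [norm_sub_rev (T y) x] at h4
  have h7 := mul_le_mul_of_nonneg_left h2 hb0
  have h8 := mul_le_mul_of_nonneg_left h3 hb0
  have h9 : ‖T y - p‖ ^ 2 ≤ ‖x - p‖ ^ 2 - b * (1 - 2 * b - L ^ 2 * b ^ 2) * ‖x - T x‖ ^ 2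
      + (1 - b) * ‖x - T y‖ ^ 2 := by nlinarith
  have h10 := mul_le_mul_of_nonneg_left h9 ha
  have h11 : 0 ≤ a * (b - a) * ‖x - T y‖ ^ 2 :=
    mul_nonneg (mul_nonneg ha (by linarith)) (sq_nonneg _)
  nlinarith

/-- If `w` has divergent sums and `w n * r n` is bounded by the decrease of a nonnegative
sequence, then `r` is small infinitely often. -/
theorem frequently_lt_of_mul_le_sub {w r d : ℕ → ℝ} (hw : ∀ n, 0 ≤ w n) (hd : ∀ n, 0 ≤ d n)
    (hsum : Filter.Tendsto (fun n => ∑ i ∈ Finset.range n, w i) Filter.atTop Filter.atTop)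
    (h : ∀ᶠ n in Filter.atTop, w n * r n ≤ d n - d (n + 1)) {ε : ℝ} (hε : 0 < ε) :
    ∃ᶠ n in Filter.atTop, r n < ε := by
  intro hev
  obtain ⟨N, hN⟩ := Filter.eventually_atTop.1 (h.and hev)
  have key : ∀ n ≥ N, ε * ∑ i ∈ Finset.range n, w i + d n ≤
      ε * ∑ i ∈ Finset.range N, w i + d N := by
    intro n hn
    induction n, hn using Nat.le_induction with
    | base => exact le_rfl
    | succ n hn ih =>
      rw [Finset.sum_range_succ]
      have := mul_le_mul_of_nonneg_left (not_lt.1 (hN n hn).2) (hw n)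
      linarith [(hN n hn).1]
  obtain ⟨n, hn, hnN⟩ := ((hsum.const_mul_atTop hε).eventually_gt_atTop
    (ε * ∑ i ∈ Finset.range N, w i + d N) |>.and (Filter.eventually_ge_atTop N)).exists
  linarith [key n hnN, hd n]


/-- Ishikawa's theorem. For a Lipschitzian pseudo-contraction on a nonempty
convex compact subset of a real Hilbert space, with weights satisfying (A1)-(A3), the
Ishikawa iteration converges strongly to a fixed point of `T`. -/
theorem ishikawa_strong_convergence
    {H : Type*} [NormedAddCommGroup H] [InnerProductSpace ℝ H]
    (C : Set H) (hCne : C.Nonempty) (hCconv : Convex ℝ C) (hCcomp : IsCompact C)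
    (T : H → H) (hTmap : ∀ c ∈ C, T c ∈ C)
    (L : ℝ) (hL : 0 < L)
    (hLip : ∀ c ∈ C, ∀ d ∈ C, ‖T c - T d‖ ≤ L * ‖c - d‖)
    (hPC : ∀ c ∈ C, ∀ d ∈ C,
      ‖T c - T d‖ ^ 2 ≤ ‖c - d‖ ^ 2 + ‖(c - T c) - (d - T d)‖ ^ 2)
    (α β : ℕ → ℝ)
    (hα : ∀ n, α n ∈ Set.Icc (0 : ℝ) 1) (hβmem : ∀ n, β n ∈ Set.Icc (0 : ℝ) 1)
    (hA1 : Filter.Tendsto β Filter.atTop (nhds 0))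
    (hA2 : Filter.Tendsto (fun n => ∑ i ∈ Finset.range n, α i * β i)
      Filter.atTop Filter.atTop)
    (hA3 : ∀ n, α n ≤ β n)
    (x₀ : H) (hx₀ : x₀ ∈ C)
    (x y : ℕ → H) (hx0 : x 0 = x₀)
    (hy : ∀ n, y n = β n • T (x n) + (1 - β n) • x n)
    (hxs : ∀ n, x (n + 1) = α n • T (y n) + (1 - α n) • x n) :
    ∃ q ∈ C, T q = q ∧ Filter.Tendsto x Filter.atTop (nhds q) := by
  have hT : ContinuousOn T C := by
    refine (LipschitzOnWith.of_dist_le_mul (K := ⟨L, hL.le⟩) fun c hc d hd => ?_).continuousOn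
    rw [dist_eq_norm, dist_eq_norm]
    exact hLip c hc d hd
  have hxC : ∀ n, x n ∈ C := by
    intro n
    induction n with
    | zero => exact hx0 ▸ hx₀
    | succ n ih =>
      have hyC : y n ∈ C := hy n ▸ hCconv (hTmap _ ih) ih (hβmem n).1
        (sub_nonneg.2 (hβmem n).2) (by ring)
      exact hxs n ▸ hCconv (hTmap _ hyC) ih (hα n).1 (sub_nonneg.2 (hα n).2) (by ring)
  have hsmall : ∀ᶠ n in Filter.atTop, 2 * β n + L ^ 2 * β n ^ 2 < 1 / 2 := by
    have h : Filter.Tendsto (fun n => 2 * β n + L ^ 2 * β n ^ 2) Filter.atTop (nhds 0) := by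
      simpa using (hA1.const_mul 2).add ((hA1.pow 2).const_mul (L ^ 2))
    exact h.eventually_lt_const (by norm_num)
  obtain ⟨N, hN⟩ := Filter.eventually_atTop.1 hsmall
  have hstep : ∀ p ∈ C, T p = p → ∀ n ≥ N,
      α n * β n * (‖x n - T (x n)‖ ^ 2 / 2) ≤ ‖x n - p‖ ^ 2 - ‖x (n + 1) - p‖ ^ 2 := by
    intro p hp hTp n hn
    have h := ishikawa_step_norm_sq_le hCconv hTmap hLip hPC (hα n).1 (hA3 n) (hβmem n).2 hp hTp
      (hxC n) (hy n)
    rw [← hxs n] at h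
    have h1 : 0 ≤ α n * β n * ‖x n - T (x n)‖ ^ 2 :=
      mul_nonneg (mul_nonneg (hα n).1 (hβmem n).1) (sq_nonneg _)
    nlinarith [mul_le_mul_of_nonneg_left (hN n hn).le h1]
  obtain ⟨p, hp, hTp⟩ :=
    exists_fixedPoint_of_pseudocontraction hCne hCconv hCcomp hTmap hT hLip hPC
  have hfreq : ∀ k : ℕ, ∃ n ≥ k, ‖x n - T (x n)‖ ^ 2 / 2 < 1 / ((k : ℝ) + 1) := fun k =>
    Filter.frequently_atTop.1 (frequently_lt_of_mul_le_sub
      (fun n => mul_nonneg (hα n).1 (hβmem n).1) (fun n => sq_nonneg ‖x n - p‖) hA2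
      (Filter.eventually_atTop.2 ⟨N, hstep p hp hTp⟩) (by positivity)) k
  choose m hmk hm using hfreq
  obtain ⟨q, hq, φ, hφ, hlim⟩ := hCcomp.tendsto_subseq fun k => hxC (m k)
  have hres : Filter.Tendsto (fun k => ‖x (m k) - T (x (m k))‖ ^ 2 / 2) Filter.atTop (nhds 0) :=
    squeeze_zero (fun k => by positivity) (fun k => (hm k).le)
      tendsto_one_div_add_atTop_nhds_zero_nat
  have hTlim : Filter.Tendsto (fun k => T (x (m (φ k)))) Filter.atTop (nhds (T q)) :=
    (hT q hq).tendsto.comp (tendsto_nhdsWithin_iff.2 ⟨hlim, .of_forall fun k => hxC _⟩)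
  have hTq : T q = q := by
    have h := tendsto_nhds_unique (((hlim.sub hTlim).norm.pow 2).div_const 2)
      (hres.comp hφ.tendsto_atTop)
    have h1 : ‖q - T q‖ = 0 := by
      apply pow_eq_zero_iff (two_ne_zero) |>.1
      linarith
    exact (sub_eq_zero.1 (norm_eq_zero.1 h1)).symm
  refine ⟨q, hq, hTq, ?_⟩
  have hanti : ∀ k ≥ N, ∀ n ≥ k, ‖x n - q‖ ≤ ‖x k - q‖ := by
    intro k hk n hn
    induction n, hn using Nat.le_induction with
    | base => exact le_rfl
    | succ n hn ih =>
      refine le_trans (le_of_sq_le_sq ?_ (norm_nonneg _)) ih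
      have h1 : 0 ≤ α n * β n * (‖x n - T (x n)‖ ^ 2 / 2) :=
        mul_nonneg (mul_nonneg (hα n).1 (hβmem n).1) (by positivity)
      linarith [hstep q hq hTq n (hk.trans hn)]
  rw [Metric.tendsto_atTop]
  intro ε hε
  obtain ⟨k, hk, hkN⟩ := ((Metric.tendsto_nhds.1 hlim ε hε).and
    (Filter.eventually_ge_atTop N)).exists
  refine ⟨m (φ k), fun n hn => ?_⟩
  rw [Function.comp_apply, dist_eq_norm] at hk
  rw [dist_eq_norm]
  exact (hanti _ (hkN.trans ((hφ.id_le k).trans (hmk _))) n hn).trans_lt hk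
end

section
/- Let H be a real Hilbert space, C ⊆ H a nonempty convex subset, and T : C → C a pseudo-contraction. Then for every z, p ∈ C, ‖Tz − p‖² ≤ ‖z − p‖² + ‖z − Tz‖² + 2‖p − Tp‖·σ(z, p), where σ(z, p) := ‖p − Tp‖ + ‖z − Tp‖. -/
/-- For a pseudo-contraction `T` and `z, p ∈ C`,
`‖Tz − p‖² ≤ ‖z − p‖² + ‖z − Tz‖² + 2‖p − Tp‖·σ(z,p)` where
`σ(z,p) = ‖p − Tp‖ + ‖z − Tp‖`. -/
theorem pseudoContraction_approx_triangle
    {H : Type*} [NormedAddCommGroup H] [InnerProductSpace ℝ H]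
    (C : Set H) (hCne : C.Nonempty) (hCconv : Convex ℝ C)
    (T : H → H) (hTmap : ∀ c ∈ C, T c ∈ C)
    (hPC : ∀ c ∈ C, ∀ d ∈ C,
      ‖T c - T d‖ ^ 2 ≤ ‖c - d‖ ^ 2 + ‖(c - T c) - (d - T d)‖ ^ 2) :
    ∀ z ∈ C, ∀ p ∈ C,
      ‖T z - p‖ ^ 2 ≤ ‖z - p‖ ^ 2 + ‖z - T z‖ ^ 2 +
        2 * ‖p - T p‖ * (‖p - T p‖ + ‖z - T p‖) := by
  intro z hz p hp
  have hmono : 0 ≤ inner ℝ ((z - T z) - (p - T p)) (z - p) := by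
    have h := hPC z hz p hp
    have hdiff : T z - T p = (z - p) - ((z - T z) - (p - T p)) := by abel
    rw [hdiff, norm_sub_sq_real, real_inner_comm] at h
    linarith
  rw [inner_sub_left] at hmono
  have hcs : -inner ℝ (p - T p) (z - p) ≤ ‖p - T p‖ * ‖z - p‖ :=
    (neg_le_abs _).trans (abs_real_inner_le_norm _ _)
  have htri : ‖z - p‖ ≤ ‖p - T p‖ + ‖z - T p‖ := by
    rw [add_comm, norm_sub_rev p]
    exact norm_sub_le_norm_sub_add_norm_sub z (T p) p
  have hmul := mul_le_mul_of_nonneg_left htri (norm_nonneg (p - T p))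
  have hexp : T z - p = (z - p) - (z - T z) := by abel
  rw [hexp, norm_sub_sq_real, real_inner_comm]
  linarith
end

section
/- Let H be a real Hilbert space, C ⊆ H a nonempty convex subset, T : C → C an L-Lipschitzian pseudo-contraction (L > 0), (αₙ), (βₙ) sequences in [0,1] with αₙ ≤ βₙ for all n, x ∈ C, and (xₙ), (yₙ) the Ishikawa iteration starting at x. Then for every p ∈ C and every n ∈ ℕ: ‖xₙ₊₁ − p‖² ≤ ‖xₙ − p‖² − αₙβₙ(1 − 2βₙ − L²βₙ²)‖xₙ − Txₙ‖² + 2‖p − Tp‖·(σ(xₙ, p) + σ(yₙ, p)), where σ(y, w) := ‖w − Tw‖ + ‖y − Tw‖. -/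
theorem norm_sq_smul_add_smul_sub {H : Type*} [NormedAddCommGroup H] [InnerProductSpace ℝ H]
    (t : ℝ) (a b p : H) :
    ‖t • a + (1 - t) • b - p‖ ^ 2 =
      t * ‖a - p‖ ^ 2 + (1 - t) * ‖b - p‖ ^ 2 - t * (1 - t) * ‖a - b‖ ^ 2 := by
  have h₁ : t • a + (1 - t) • b - p = t • (a - p) + (1 - t) • (b - p) := by module
  have h₂ : a - b = (a - p) - (b - p) := by abel
  rw [h₁, h₂, norm_add_sq_real, norm_sub_sq_real (a - p) (b - p), norm_smul, norm_smul,
    inner_smul_left, inner_smul_right, mul_pow, mul_pow, Real.norm_eq_abs, Real.norm_eq_abs, sq_abs, sq_abs]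
  simp only [conj_trivial]
  ring

/-- The pseudo-contraction inequality for the pair `(u, p)`, with images `v` and `q`, bounds the
distance from `v` to `p` even when `p` is not fixed. -/
theorem norm_sq_sub_le_of_pseudocontraction {H : Type*} [NormedAddCommGroup H]
    [InnerProductSpace ℝ H] {u v p q : H}
    (h : ‖v - q‖ ^ 2 ≤ ‖u - p‖ ^ 2 + ‖(u - v) - (p - q)‖ ^ 2) :
    ‖v - p‖ ^ 2 ≤
      ‖u - p‖ ^ 2 + ‖u - v‖ ^ 2 + 2 * ‖p - q‖ * (‖p - q‖ + ‖u - q‖) := by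
  have h₁ : v - q = (u - p) - ((u - v) - (p - q)) := by abel
  have h₂ : v - p = (u - p) - (u - v) := by abel
  rw [h₁, norm_sub_sq_real, inner_sub_right] at h
  rw [h₂, norm_sub_sq_real]
  have h₃ : -(‖u - p‖ * ‖p - q‖) ≤ inner ℝ (u - p) (p - q) :=
    neg_le_of_abs_le (abs_real_inner_le_norm _ _)
  have h₄ : ‖u - p‖ ≤ ‖p - q‖ + ‖u - q‖ := by
    have := norm_sub_le_norm_sub_add_norm_sub u q p
    rw [norm_sub_rev q p] at this
    linarith
  have h₅ := mul_le_mul_of_nonneg_right h₄ (norm_nonneg (p - q))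
  linarith

/-- refined inequality for the Ishikawa iteration of an `L`-Lipschitzian
pseudo-contraction under (A3), where `σ(y,w) = ‖w − Tw‖ + ‖y − Tw‖`. -/
theorem ishikawa_key_inequality_lipschitz
    {H : Type*} [NormedAddCommGroup H] [InnerProductSpace ℝ H]
    (C : Set H) (hCne : C.Nonempty) (hCconv : Convex ℝ C)
    (T : H → H) (hTmap : ∀ c ∈ C, T c ∈ C)
    (L : ℝ) (hL : 0 < L)
    (hLip : ∀ c ∈ C, ∀ d ∈ C, ‖T c - T d‖ ≤ L * ‖c - d‖)
    (hPC : ∀ c ∈ C, ∀ d ∈ C,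
      ‖T c - T d‖ ^ 2 ≤ ‖c - d‖ ^ 2 + ‖(c - T c) - (d - T d)‖ ^ 2)
    (α β : ℕ → ℝ)
    (hα : ∀ n, α n ∈ Set.Icc (0 : ℝ) 1) (hβmem : ∀ n, β n ∈ Set.Icc (0 : ℝ) 1)
    (hA3 : ∀ n, α n ≤ β n)
    (x₀ : H) (hx₀ : x₀ ∈ C)
    (x y : ℕ → H) (hx0 : x 0 = x₀)
    (hy : ∀ n, y n = β n • T (x n) + (1 - β n) • x n)
    (hxs : ∀ n, x (n + 1) = α n • T (y n) + (1 - α n) • x n) :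
    ∀ p ∈ C, ∀ n : ℕ,
      ‖x (n + 1) - p‖ ^ 2 ≤
        ‖x n - p‖ ^ 2
          - α n * β n * (1 - 2 * β n - L ^ 2 * β n ^ 2) * ‖x n - T (x n)‖ ^ 2
          + 2 * ‖p - T p‖ *
              ((‖p - T p‖ + ‖x n - T p‖) + (‖p - T p‖ + ‖y n - T p‖)) := by
  have hyC : ∀ n, x n ∈ C → y n ∈ C := fun n hn => by
    rw [hy]
    exact hCconv (hTmap _ hn) hn (hβmem n).1 (sub_nonneg.2 (hβmem n).2) (by ring)
  have hxC : ∀ n, x n ∈ C := fun n => by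
    induction n with
    | zero => rwa [hx0]
    | succ n hn =>
      rw [hxs]
      exact hCconv (hTmap _ (hyC n hn)) hn (hα n).1 (sub_nonneg.2 (hα n).2) (by ring)
  intro p hp n
  have hu := hxC n
  have hw := hyC n hu
  obtain ⟨ha0, ha1⟩ := hα n
  obtain ⟨hb0, hb1⟩ := hβmem n
  have hab := hA3 n
  have hTx := norm_sq_sub_le_of_pseudocontraction (hPC _ hu p hp)
  have hTy := norm_sq_sub_le_of_pseudocontraction (hPC _ hw p hp)
  have hyp := norm_sq_smul_add_smul_sub (β n) (T (x n)) (x n) p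
  have hyTy := norm_sq_smul_add_smul_sub (β n) (T (x n)) (x n) (T (y n))
  have hxp := norm_sq_smul_add_smul_sub (α n) (T (y n)) (x n) p
  rw [← hy, norm_sub_rev (T (x n)) (x n)] at hyp hyTy
  rw [← hxs, norm_sub_rev (T (y n)) (x n)] at hxp
  have hdist : ‖x n - y n‖ = β n * ‖x n - T (x n)‖ := by
    have : x n - y n = β n • (x n - T (x n)) := by rw [hy]; module
    rw [this, norm_smul, Real.norm_of_nonneg hb0]
  have hTT : ‖T (x n) - T (y n)‖ ^ 2 ≤ L ^ 2 * β n ^ 2 * ‖x n - T (x n)‖ ^ 2 := by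
    have := pow_le_pow_left₀ (norm_nonneg _) (hLip _ hu _ hw) 2
    rw [hdist] at this
    linarith
  have hσx : 0 ≤ 2 * ‖p - T p‖ * (‖p - T p‖ + ‖x n - T p‖) := by positivity
  have hσy : 0 ≤ 2 * ‖p - T p‖ * (‖p - T p‖ + ‖y n - T p‖) := by positivity
  rw [mul_add (2 * ‖p - T p‖)]
  generalize 2 * ‖p - T p‖ * (‖p - T p‖ + ‖x n - T p‖) = σx at *
  generalize 2 * ‖p - T p‖ * (‖p - T p‖ + ‖y n - T p‖) = σy at *
  have e₁ := mul_le_mul_of_nonneg_left hTx (mul_nonneg ha0 hb0)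
  have e₂ := mul_le_mul_of_nonneg_left hTy ha0
  have e₃ := mul_le_mul_of_nonneg_left hTT (mul_nonneg ha0 hb0)
  have e₄ := mul_nonneg (mul_nonneg ha0 (sub_nonneg.2 hab)) (sq_nonneg ‖x n - T (y n)‖)
  have e₅ := mul_le_mul_of_nonneg_right (mul_le_one₀ ha1 hb0 hb1) hσx
  have e₆ := mul_le_mul_of_nonneg_right ha1 hσy
  rw [hyp, hyTy] at e₂
  rw [hxp]
  linarith
end

section
/- Let H be a real Hilbert space, C ⊆ H a nonempty bounded convex subset with diameter at most b ∈ ℕ, T : C → C an L-Lipschitzian pseudo-contraction (L > 0), (αₙ), (βₙ) sequences in [0,1] with αₙ ≤ βₙ for all n and lim βₙ = 0, β a rate of convergence of (βₙ), and K := β(⌈1 + √(2L² + 4)⌉). Let (xₙ) be the Ishikawa iteration starting at some x ∈ C. Then for all n ≥ K and all p ∈ C: ‖xₙ₊₁ − p‖² ≤ ‖xₙ − p‖² − (1/2)·αₙβₙ·‖xₙ − Txₙ‖² + 8b‖p − Tp‖. -/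
section Helpers

variable {H : Type*} [NormedAddCommGroup H] [InnerProductSpace ℝ H]

theorem norm_sq_convexComb_sub (t : ℝ) (u v w : H) :
    ‖t • u + (1 - t) • v - w‖ ^ 2
      = t * ‖u - w‖ ^ 2 + (1 - t) * ‖v - w‖ ^ 2 - t * (1 - t) * ‖u - v‖ ^ 2 := by
  have h₁ : t • u + (1 - t) • v - w = t • (u - w) + (1 - t) • (v - w) := by module
  have h₂ : u - v = (u - w) - (v - w) := by abel
  rw [h₁, h₂, norm_add_sq_real, norm_sub_sq_real (u - w) (v - w), norm_smul, norm_smul,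
    mul_pow, mul_pow, Real.norm_eq_abs, Real.norm_eq_abs, sq_abs, sq_abs,
    real_inner_smul_left, real_inner_smul_right]
  ring

/-- A pseudo-contraction satisfies the hemicontractive inequality at `p` up to an error
controlled by `‖p - T p‖`; here `u' = T u` and `q = T p`. -/
theorem norm_sq_sub_le_of_pseudoContraction {u u' p q : H} {b : ℝ} (hb : ‖u - p‖ ≤ b)
    (h : ‖u' - q‖ ^ 2 ≤ ‖u - p‖ ^ 2 + ‖(u - u') - (p - q)‖ ^ 2) :
    ‖u' - p‖ ^ 2 ≤ ‖u - p‖ ^ 2 + ‖u - u'‖ ^ 2 + 2 * b * ‖p - q‖ := by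
  have h₁ : u' - q = (u' - p) + (p - q) := by abel
  have h₂ : inner ℝ (u - u') (p - q) = inner ℝ (u - p) (p - q) - inner ℝ (u' - p) (p - q) := by
    rw [← inner_sub_left]
    congr 1
    abel
  rw [h₁, norm_add_sq_real, norm_sub_sq_real (u - u'), h₂] at h
  have h₃ : -inner ℝ (u - p) (p - q) ≤ b * ‖p - q‖ :=
    (neg_le_abs _).trans ((abs_real_inner_le_norm _ _).trans
      (mul_le_mul_of_nonneg_right hb (norm_nonneg _)))
  linarith

theorem two_mul_add_sq_mul_sq_le_half {L s : ℝ} {k : ℕ} (hs : 0 ≤ s)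
    (hk : 1 + √(2 * L ^ 2 + 4) ≤ k) (hsk : s ≤ 1 / ((k : ℝ) + 1)) :
    2 * s + L ^ 2 * s ^ 2 ≤ 1 / 2 := by
  have hr : √(2 * L ^ 2 + 4) ^ 2 = 2 * L ^ 2 + 4 := Real.sq_sqrt (by positivity)
  have hr₀ : 0 ≤ √(2 * L ^ 2 + 4) := Real.sqrt_nonneg _
  set r := √(2 * L ^ 2 + 4)
  have h₁ : s * (k + 1) ≤ 1 := (le_div_iff₀ (by positivity)).1 hsk
  have h₂ : s * r ≤ 1 - 2 * s := by nlinarith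
  have h₃ : (s * r) ^ 2 ≤ (1 - 2 * s) ^ 2 := pow_le_pow_left₀ (by positivity) h₂ 2
  rw [mul_pow, hr] at h₃
  linarith

end Helpers


/-- for `n ≥ K` and `p ∈ C`,
`‖xₙ₊₁ − p‖² ≤ ‖xₙ − p‖² − (1/2)·αₙβₙ·‖xₙ − Txₙ‖² + 8b‖p − Tp‖`. -/
theorem ishikawa_fejer_type_inequality_bounded
    {H : Type*} [NormedAddCommGroup H] [InnerProductSpace ℝ H]
    (C : Set H) (hCne : C.Nonempty) (hCconv : Convex ℝ C)
    (b : ℕ) (hb : ∀ c ∈ C, ∀ d ∈ C, ‖c - d‖ ≤ (b : ℝ))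
    (T : H → H) (hTmap : ∀ c ∈ C, T c ∈ C)
    (L : ℝ) (hL : 0 < L)
    (hLip : ∀ c ∈ C, ∀ d ∈ C, ‖T c - T d‖ ≤ L * ‖c - d‖)
    (hPC : ∀ c ∈ C, ∀ d ∈ C,
      ‖T c - T d‖ ^ 2 ≤ ‖c - d‖ ^ 2 + ‖(c - T c) - (d - T d)‖ ^ 2)
    (α β : ℕ → ℝ)
    (hα : ∀ n, α n ∈ Set.Icc (0 : ℝ) 1) (hβmem : ∀ n, β n ∈ Set.Icc (0 : ℝ) 1)
    (hA3 : ∀ n, α n ≤ β n)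
    (hβ0 : Filter.Tendsto β Filter.atTop (nhds 0))
    (ρ : ℕ → ℕ) (hρ : ∀ k : ℕ, ∀ n : ℕ, ρ k ≤ n → β n ≤ 1 / ((k : ℝ) + 1))
    (K : ℕ) (hK : K = ρ ⌈1 + Real.sqrt (2 * L ^ 2 + 4)⌉₊)
    (x₀ : H) (hx₀ : x₀ ∈ C)
    (x y : ℕ → H) (hx0 : x 0 = x₀)
    (hy : ∀ n, y n = β n • T (x n) + (1 - β n) • x n)
    (hxs : ∀ n, x (n + 1) = α n • T (y n) + (1 - α n) • x n) :
    ∀ n : ℕ, K ≤ n → ∀ p ∈ C,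
      ‖x (n + 1) - p‖ ^ 2 ≤
        ‖x n - p‖ ^ 2 - (1 / 2) * (α n * β n) * ‖x n - T (x n)‖ ^ 2
          + 8 * (b : ℝ) * ‖p - T p‖ := by
  have hyC : ∀ n, x n ∈ C → y n ∈ C := fun n hn => by
    rw [hy]
    exact hCconv (hTmap _ hn) hn (hβmem n).1 (sub_nonneg.2 (hβmem n).2) (by ring)
  have hxC : ∀ n, x n ∈ C := fun n => by
    induction n with
    | zero => rwa [hx0]
    | succ n ih =>
      rw [hxs]
      exact hCconv (hTmap _ (hyC n ih)) ih (hα n).1 (sub_nonneg.2 (hα n).2) (by ring)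
  intro n hn p hp
  have hx := hxC n
  have hyn := hyC n hx
  obtain ⟨hα₀, -⟩ := hα n
  obtain ⟨hβ₀, hβ₁⟩ := hβmem n
  have hαβ := hA3 n
  have hsmall : 2 * β n + L ^ 2 * β n ^ 2 ≤ 1 / 2 :=
    two_mul_add_sq_mul_sq_le_half hβ₀ (Nat.le_ceil _) (hρ _ n (hK ▸ hn))
  have hTx := norm_sq_sub_le_of_pseudoContraction (hb _ hx p hp) (hPC _ hx p hp)
  have hTy := norm_sq_sub_le_of_pseudoContraction (hb _ hyn p hp) (hPC _ hyn p hp)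
  have hstep := norm_sq_convexComb_sub (α n) (T (y n)) (x n) p
  have hyp := norm_sq_convexComb_sub (β n) (T (x n)) (x n) p
  have hyTy := norm_sq_convexComb_sub (β n) (T (x n)) (x n) (T (y n))
  rw [← hxs, norm_sub_rev (T (y n)) (x n)] at hstep
  rw [← hy, norm_sub_rev (T (x n)) (x n)] at hyp hyTy
  have hxy : ‖x n - y n‖ = β n * ‖x n - T (x n)‖ := by
    have : x n - y n = β n • (x n - T (x n)) := by rw [hy]; module
    rw [this, norm_smul, Real.norm_of_nonneg hβ₀]
  have hLxy : ‖T (x n) - T (y n)‖ ^ 2 ≤ L ^ 2 * β n ^ 2 * ‖x n - T (x n)‖ ^ 2 := by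
    have := pow_le_pow_left₀ (norm_nonneg _) (hLip _ hx _ hyn) 2
    rw [hxy] at this
    linarith
  have he : 0 ≤ (b : ℝ) * ‖p - T p‖ := by positivity
  set e := (b : ℝ) * ‖p - T p‖
  set d := ‖x n - T (x n)‖ ^ 2
  have hd : 0 ≤ d := sq_nonneg _
  have hyp' : ‖y n - p‖ ^ 2 ≤ ‖x n - p‖ ^ 2 + β n ^ 2 * d + 2 * e := by
    have h₁ := mul_le_mul_of_nonneg_left hTx hβ₀
    have h₂ := mul_le_mul_of_nonneg_right hβ₁ he
    linarith
  have hTyp : ‖T (y n) - p‖ ^ 2 ≤ ‖x n - p‖ ^ 2 + 4 * e + (1 - β n) * ‖x n - T (y n)‖ ^ 2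
      - (1 / 2) * β n * d := by
    have h₁ := mul_le_mul_of_nonneg_left hLxy hβ₀
    have h₂ := mul_le_mul_of_nonneg_left hsmall (mul_nonneg hβ₀ hd)
    linarith
  have h₁ := mul_le_mul_of_nonneg_left hTyp hα₀
  have h₂ := mul_le_mul_of_nonneg_right (hα n).2 he
  have h₃ : α n * α n * ‖x n - T (y n)‖ ^ 2 ≤ α n * β n * ‖x n - T (y n)‖ ^ 2 := by gcongr
  linarith
end

section
/- Let H be a real Hilbert space, C ⊆ H a nonempty convex subset, T : C → C an L-Lipschitzian pseudo-contraction (L > 0), (αₙ), (βₙ) sequences in [0,1] with αₙ ≤ βₙ for all n and lim βₙ = 0, β a rate of convergence of (βₙ), and K := β(⌈1 + √(2L² + 4)⌉). Let (xₙ) be the Ishikawa iteration starting at some x ∈ C. Then for every fixed point p of T and all n ≥ K: ‖xₙ₊₁ − p‖² ≤ ‖xₙ − p‖² − (1/2)·αₙβₙ·‖xₙ − Txₙ‖². In particular, (‖xₙ − p‖) is nonincreasing from index K onwards. -/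
/-- Expansion of the squared norm of a convex combination. -/
lemma norm_convexComb_sq {H : Type*} [NormedAddCommGroup H] [InnerProductSpace ℝ H]
    (t : ℝ) (u v : H) :
    ‖t • v + (1 - t) • u‖ ^ 2
      = t * ‖v‖ ^ 2 + (1 - t) * ‖u‖ ^ 2 - t * (1 - t) * ‖u - v‖ ^ 2 := by
  rw [norm_add_sq_real, norm_sub_sq_real, norm_smul, norm_smul, mul_pow, mul_pow,
    Real.norm_eq_abs, Real.norm_eq_abs, sq_abs, sq_abs, inner_smul_left, inner_smul_right,
    real_inner_comm u v]
  simp only [conj_trivial]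
  ring

/-- Below the threshold `1 / (2 + √(2L² + 4))`, the factor `1 - 2b - L²b²` is at least `1/2`. -/
lemma half_le_one_sub_of_le {L b : ℝ} (hb0 : 0 ≤ b)
    (hb : b * (2 + Real.sqrt (2 * L ^ 2 + 4)) ≤ 1) :
    1 / 2 ≤ 1 - 2 * b - L ^ 2 * b ^ 2 := by
  set s := Real.sqrt (2 * L ^ 2 + 4)
  have hs : s ^ 2 = 2 * L ^ 2 + 4 := Real.sq_sqrt (by positivity)
  have hs0 : 0 ≤ s := Real.sqrt_nonneg _
  have hsb : b * s ≤ 1 - 2 * b := by linarith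
  have hsq : (b * s) ^ 2 ≤ (1 - 2 * b) ^ 2 := pow_le_pow_left₀ (by positivity) hsb 2
  rw [mul_pow, hs] at hsq
  linarith

/-- One step of the Ishikawa iteration, relative to a fixed point placed at the origin:
`u`, `v`, `w` stand for `x - p`, `T x - p` and `T y - p`. -/
lemma norm_ishikawa_step_sq_le {H : Type*} [NormedAddCommGroup H] [InnerProductSpace ℝ H]
    {a b L : ℝ} {u v w : H} (ha : 0 ≤ a) (hb : 0 ≤ b) (hab : a ≤ b)
    (hv : ‖v‖ ^ 2 ≤ ‖u‖ ^ 2 + ‖u - v‖ ^ 2)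
    (hw : ‖w‖ ^ 2 ≤ ‖b • v + (1 - b) • u‖ ^ 2 + ‖b • v + (1 - b) • u - w‖ ^ 2)
    (hvw : ‖v - w‖ ≤ L * (b * ‖u - v‖)) :
    ‖a • w + (1 - a) • u‖ ^ 2
      ≤ ‖u‖ ^ 2 - (1 - 2 * b - L ^ 2 * b ^ 2) * (a * b) * ‖u - v‖ ^ 2 := by
  have hsplit : b • v + (1 - b) • u - w = b • (v - w) + (1 - b) • (u - w) := by module
  rw [hsplit, norm_convexComb_sq, norm_convexComb_sq, sub_sub_sub_cancel_right] at hw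
  have hvw' : ‖v - w‖ ^ 2 ≤ (L * (b * ‖u - v‖)) ^ 2 :=
    pow_le_pow_left₀ (norm_nonneg _) hvw 2
  have hbv := mul_le_mul_of_nonneg_left hv hb
  have hbvw := mul_le_mul_of_nonneg_left hvw' hb
  have hw' : ‖w‖ ^ 2 ≤ ‖u‖ ^ 2 - (1 - 2 * b - L ^ 2 * b ^ 2) * b * ‖u - v‖ ^ 2
      + (1 - b) * ‖u - w‖ ^ 2 := by linarith
  have haw := mul_le_mul_of_nonneg_left hw' ha
  have habw : 0 ≤ a * (b - a) * ‖u - w‖ ^ 2 :=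
    mul_nonneg (mul_nonneg ha (sub_nonneg.2 hab)) (sq_nonneg _)
  rw [norm_convexComb_sq]
  linarith

/-- for a fixed point `p` of `T` and all `n ≥ K`,
`‖xₙ₊₁ − p‖² ≤ ‖xₙ − p‖² − (1/2)·αₙβₙ·‖xₙ − Txₙ‖²`; in particular `(‖xₙ − p‖)`
is nonincreasing from index `K` onwards. -/
theorem ishikawa_fejer_type_inequality_fixedPoint
    {H : Type*} [NormedAddCommGroup H] [InnerProductSpace ℝ H]
    (C : Set H) (hCne : C.Nonempty) (hCconv : Convex ℝ C)
    (T : H → H) (hTmap : ∀ c ∈ C, T c ∈ C)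
    (L : ℝ) (hL : 0 < L)
    (hLip : ∀ c ∈ C, ∀ d ∈ C, ‖T c - T d‖ ≤ L * ‖c - d‖)
    (hPC : ∀ c ∈ C, ∀ d ∈ C,
      ‖T c - T d‖ ^ 2 ≤ ‖c - d‖ ^ 2 + ‖(c - T c) - (d - T d)‖ ^ 2)
    (α β : ℕ → ℝ)
    (hα : ∀ n, α n ∈ Set.Icc (0 : ℝ) 1) (hβmem : ∀ n, β n ∈ Set.Icc (0 : ℝ) 1)
    (hA3 : ∀ n, α n ≤ β n)
    (hβ0 : Filter.Tendsto β Filter.atTop (nhds 0))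
    (ρ : ℕ → ℕ) (hρ : ∀ k : ℕ, ∀ n : ℕ, ρ k ≤ n → β n ≤ 1 / ((k : ℝ) + 1))
    (K : ℕ) (hK : K = ρ ⌈1 + Real.sqrt (2 * L ^ 2 + 4)⌉₊)
    (x₀ : H) (hx₀ : x₀ ∈ C)
    (x y : ℕ → H) (hx0 : x 0 = x₀)
    (hy : ∀ n, y n = β n • T (x n) + (1 - β n) • x n)
    (hxs : ∀ n, x (n + 1) = α n • T (y n) + (1 - α n) • x n)
    (p : H) (hp : p ∈ C) (hfix : T p = p) :
    (∀ n : ℕ, K ≤ n →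
      ‖x (n + 1) - p‖ ^ 2 ≤
        ‖x n - p‖ ^ 2 - (1 / 2) * (α n * β n) * ‖x n - T (x n)‖ ^ 2) ∧
    (∀ n : ℕ, K ≤ n → ‖x (n + 1) - p‖ ≤ ‖x n - p‖) := by
  have hcomb : ∀ t ∈ Set.Icc (0 : ℝ) 1, ∀ c ∈ C, ∀ d ∈ C, t • c + (1 - t) • d ∈ C :=
    fun t ht c hc d hd => hCconv hc hd ht.1 (sub_nonneg.2 ht.2) (add_sub_cancel _ _)
  have hyC : ∀ n, x n ∈ C → y n ∈ C := fun n hn =>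
    hy n ▸ hcomb _ (hβmem n) _ (hTmap _ hn) _ hn
  have hxC : ∀ n, x n ∈ C := by
    intro n
    induction n with
    | zero => exact hx0 ▸ hx₀
    | succ n ih => exact hxs n ▸ hcomb _ (hα n) _ (hTmap _ (hyC n ih)) _ ih
  have hfejer : ∀ n : ℕ, K ≤ n →
      ‖x (n + 1) - p‖ ^ 2 ≤
        ‖x n - p‖ ^ 2 - (1 / 2) * (α n * β n) * ‖x n - T (x n)‖ ^ 2 := by
    intro n hn
    have hb0 := (hβmem n).1
    have ha0 := (hα n).1
    have hyp : y n - p = β n • (T (x n) - p) + (1 - β n) • (x n - p) := by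
      rw [hy n]; module
    have hxp : x (n + 1) - p = α n • (T (y n) - p) + (1 - α n) • (x n - p) := by
      rw [hxs n]; module
    have hv := hPC _ (hxC n) _ hp
    have hw := hPC _ (hyC n (hxC n)) _ hp
    have hvw := hLip _ (hxC n) _ (hyC n (hxC n))
    have hxy : x n - y n = β n • (x n - T (x n)) := by rw [hy n]; module
    rw [hxy, norm_smul, Real.norm_of_nonneg hb0] at hvw
    rw [hfix, sub_self, sub_zero] at hv hw
    have hstep := norm_ishikawa_step_sq_le (u := x n - p) (v := T (x n) - p)
      (w := T (y n) - p) (L := L) ha0 hb0 (hA3 n)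
      (by rwa [sub_sub_sub_cancel_right])
      (by rwa [← hyp, sub_sub_sub_cancel_right])
      (by rwa [sub_sub_sub_cancel_right, sub_sub_sub_cancel_right])
    rw [← hxp, sub_sub_sub_cancel_right] at hstep
    have hβle := hρ _ n (hK ▸ hn)
    rw [le_div_iff₀ (by positivity)] at hβle
    have hceil := Nat.le_ceil (1 + Real.sqrt (2 * L ^ 2 + 4))
    have hhalf := half_le_one_sub_of_le (L := L) hb0
      ((mul_le_mul_of_nonneg_left (by linarith) hb0).trans hβle)
    have hnonneg : 0 ≤ α n * β n * ‖x n - T (x n)‖ ^ 2 := by positivity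
    linarith [mul_le_mul_of_nonneg_right hhalf hnonneg]
  refine ⟨hfejer, fun n hn => (pow_le_pow_iff_left₀ (norm_nonneg _) (norm_nonneg _) two_ne_zero).1 ?_⟩
  have hb0 := (hβmem n).1
  have ha0 := (hα n).1
  exact (hfejer n hn).trans (sub_le_self _ (by positivity))
end

section
/- Let H be a real Hilbert space, C ⊆ H a nonempty convex subset, T : C → C an L-Lipschitzian pseudo-contraction (L > 0), (αₙ), (βₙ) sequences in [0,1] with αₙ ≤ βₙ for all n and lim βₙ = 0, β a rate of convergence of (βₙ), K := β(⌈1 + √(2L² + 4)⌉), and θ a rate of divergence of the series ∑ₙ α_{n+K}β_{n+K}. Let (xₙ) be the Ishikawa iteration starting at some x ∈ C and zₙ := x_{n+K}. Suppose p ∈ C is a fixed point of T and b ∈ ℕ satisfies ‖x_K − p‖ ≤ b. Then for all l, k ∈ ℕ there exists N ∈ [l, θ(l + 2(b² + 1)(k + 1)²)] with ‖z_N − Tz_N‖ ≤ 1/(k+1); i.e., Δ(l,k) := θ(l + 2(b² + 1)(k + 1)²) is a modulus of liminf for (‖zₙ − Tzₙ‖). -/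
/-- The squared distance from a convex combination to a third point. -/
theorem norm_convex_combination_sub_sq
    {H : Type*} [NormedAddCommGroup H] [InnerProductSpace ℝ H] (a : ℝ) (v w q : H) :
    ‖(a • v + (1 - a) • w) - q‖ ^ 2 =
      a * ‖v - q‖ ^ 2 + (1 - a) * ‖w - q‖ ^ 2 - a * (1 - a) * ‖w - v‖ ^ 2 := by
  have h1 : (a • v + (1 - a) • w) - q = a • (v - q) + (1 - a) • (w - q) := by module
  have h2 : w - v = (w - q) - (v - q) := by abel
  rw [h1, h2, norm_add_sq_real, norm_sub_sq_real (w - q), norm_smul, norm_smul, mul_pow, mul_pow,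
    Real.norm_eq_abs, Real.norm_eq_abs, sq_abs, sq_abs, real_inner_smul_left,
    real_inner_smul_right, real_inner_comm (w - q) (v - q)]
  ring

/-- One Ishikawa step decreases the squared distance to a fixed point of a Lipschitzian
pseudo-contraction by at least a multiple of the squared residual. -/
theorem ishikawa_step_norm_sub_sq_le
    {H : Type*} [NormedAddCommGroup H] [InnerProductSpace ℝ H] {C : Set H} {T : H → H} {L : ℝ}
    (hLip : ∀ c ∈ C, ∀ d ∈ C, ‖T c - T d‖ ≤ L * ‖c - d‖)
    (hPC : ∀ c ∈ C, ∀ d ∈ C,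
      ‖T c - T d‖ ^ 2 ≤ ‖c - d‖ ^ 2 + ‖(c - T c) - (d - T d)‖ ^ 2)
    {a s : ℝ} (ha : 0 ≤ a) (hs : 0 ≤ s) (has : a ≤ s)
    {p u v : H} (hp : p ∈ C) (hfix : T p = p) (hu : u ∈ C) (hv : v ∈ C)
    (hvu : v = s • T u + (1 - s) • u) :
    ‖(a • T v + (1 - a) • u) - p‖ ^ 2 ≤
      ‖u - p‖ ^ 2 - a * s * (1 - 2 * s - L ^ 2 * s ^ 2) * ‖u - T u‖ ^ 2 := by
  have hTu := hPC u hu p hp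
  have hTv := hPC v hv p hp
  simp only [hfix, sub_self, sub_zero] at hTu hTv
  have hvp := norm_convex_combination_sub_sq s (T u) u p
  have hvTv := norm_convex_combination_sub_sq s (T u) u (T v)
  rw [← hvu] at hvp hvTv
  have hsub : u - v = s • (u - T u) := by rw [hvu]; module
  have hLuv : ‖T u - T v‖ ^ 2 ≤ L ^ 2 * s ^ 2 * ‖u - T u‖ ^ 2 := by
    have h := pow_le_pow_left₀ (norm_nonneg _) (hLip u hu v hv) 2
    rw [hsub, norm_smul, Real.norm_eq_abs, mul_pow, mul_pow, sq_abs] at h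
    linarith
  have h1 := mul_le_mul_of_nonneg_left hTu hs
  have h2 := mul_le_mul_of_nonneg_left hLuv hs
  have h3 : ‖T v - p‖ ^ 2 ≤ ‖u - p‖ ^ 2 + (1 - s) * ‖u - T v‖ ^ 2
      - s * (1 - 2 * s - L ^ 2 * s ^ 2) * ‖u - T u‖ ^ 2 := by
    linarith
  have h4 := mul_le_mul_of_nonneg_left h3 ha
  have h5 := mul_nonneg (mul_nonneg ha (sub_nonneg.2 has)) (sq_nonneg ‖u - T v‖)
  rw [norm_convex_combination_sub_sq]
  linarith

/-- Positivity of the coefficient in the Ishikawa step estimate for small parameters. -/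
theorem half_le_one_sub_two_mul_sub_sq {L s r : ℝ} (hs : 0 ≤ s)
    (hr : 1 + √(2 * L ^ 2 + 4) ≤ r) (hsr : s ≤ 1 / (r + 1)) :
    1 / 2 ≤ 1 - 2 * s - L ^ 2 * s ^ 2 := by
  set q := √(2 * L ^ 2 + 4)
  have hq0 : 0 ≤ q := Real.sqrt_nonneg _
  have hq : q ^ 2 = 2 * L ^ 2 + 4 := Real.sq_sqrt (by positivity)
  have h1 : s * (q + 2) ≤ 1 := by
    rw [le_div_iff₀ (by linarith)] at hsr
    nlinarith
  have h2 : s * (q + 2) * (s * (q + 2)) ≤ 1 := mul_le_one₀ h1 (by positivity) h1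
  nlinarith [mul_nonneg hs hq0]


/-- `Δ(l,k) := θ(l + 2(b² + 1)(k + 1)²)` is a modulus of liminf for
`(‖zₙ − Tzₙ‖)` where `zₙ := x_{n+K}`. -/
theorem ishikawa_modulus_liminf_shifted
    {H : Type*} [NormedAddCommGroup H] [InnerProductSpace ℝ H]
    (C : Set H) (hCne : C.Nonempty) (hCconv : Convex ℝ C)
    (T : H → H) (hTmap : ∀ c ∈ C, T c ∈ C)
    (L : ℝ) (hL : 0 < L)
    (hLip : ∀ c ∈ C, ∀ d ∈ C, ‖T c - T d‖ ≤ L * ‖c - d‖)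
    (hPC : ∀ c ∈ C, ∀ d ∈ C,
      ‖T c - T d‖ ^ 2 ≤ ‖c - d‖ ^ 2 + ‖(c - T c) - (d - T d)‖ ^ 2)
    (α β : ℕ → ℝ)
    (hα : ∀ n, α n ∈ Set.Icc (0 : ℝ) 1) (hβmem : ∀ n, β n ∈ Set.Icc (0 : ℝ) 1)
    (hA3 : ∀ n, α n ≤ β n)
    (hβ0 : Filter.Tendsto β Filter.atTop (nhds 0))
    (ρ : ℕ → ℕ) (hρ : ∀ k : ℕ, ∀ n : ℕ, ρ k ≤ n → β n ≤ 1 / ((k : ℝ) + 1))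
    (K : ℕ) (hK : K = ρ ⌈1 + Real.sqrt (2 * L ^ 2 + 4)⌉₊)
    (θ : ℕ → ℕ)
    (hθ : ∀ n : ℕ, (n : ℝ) ≤ ∑ i ∈ Finset.range (θ n + 1), α (i + K) * β (i + K))
    (x₀ : H) (hx₀ : x₀ ∈ C)
    (x y : ℕ → H) (hx0 : x 0 = x₀)
    (hy : ∀ n, y n = β n • T (x n) + (1 - β n) • x n)
    (hxs : ∀ n, x (n + 1) = α n • T (y n) + (1 - α n) • x n)
    (p : H) (hp : p ∈ C) (hfix : T p = p)
    (b : ℕ) (hb : ‖x K - p‖ ≤ (b : ℝ)) :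
    ∀ l k : ℕ, ∃ N : ℕ,
      l ≤ N ∧ N ≤ θ (l + 2 * (b ^ 2 + 1) * (k + 1) ^ 2) ∧
      ‖x (N + K) - T (x (N + K))‖ ≤ 1 / ((k : ℝ) + 1) := by
  have hyC : ∀ n, x n ∈ C → y n ∈ C := fun n hn ↦ by
    rw [hy]
    exact hCconv (hTmap _ hn) hn (hβmem n).1 (sub_nonneg.2 (hβmem n).2) (by ring)
  have hxC : ∀ n, x n ∈ C := by
    intro n
    induction n with
    | zero => rwa [hx0]
    | succ n ih =>
      rw [hxs]
      exact hCconv (hTmap _ (hyC n ih)) ih (hα n).1 (sub_nonneg.2 (hα n).2) (by ring)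
  have hstep : ∀ n, ‖x (n + 1 + K) - p‖ ^ 2 +
      α (n + K) * β (n + K) * ‖x (n + K) - T (x (n + K))‖ ^ 2 / 2 ≤ ‖x (n + K) - p‖ ^ 2 := by
    intro n
    have hhalf : 1 / 2 ≤ 1 - 2 * β (n + K) - L ^ 2 * β (n + K) ^ 2 :=
      half_le_one_sub_two_mul_sub_sq (hβmem _).1 (Nat.le_ceil _) (hρ _ _ (by omega))
    have h := ishikawa_step_norm_sub_sq_le hLip hPC (hα (n + K)).1 (hβmem (n + K)).1
      (hA3 (n + K)) hp hfix (hxC (n + K)) (hyC _ (hxC _)) (hy (n + K))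
    rw [← hxs] at h
    rw [show n + 1 + K = n + K + 1 by omega]
    have h' := mul_le_mul_of_nonneg_left hhalf (mul_nonneg
      (mul_nonneg (hα (n + K)).1 (hβmem (n + K)).1) (sq_nonneg ‖x (n + K) - T (x (n + K))‖))
    linarith
  have hsum : ∀ m, ‖x (m + K) - p‖ ^ 2 + (∑ i ∈ Finset.range m,
      α (i + K) * β (i + K) * ‖x (i + K) - T (x (i + K))‖ ^ 2) / 2 ≤ (b : ℝ) ^ 2 := by
    intro m
    induction m with
    | zero => simpa using pow_le_pow_left₀ (norm_nonneg _) hb 2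
    | succ m ih =>
      rw [Finset.sum_range_succ]
      linarith [hstep m]
  intro l k
  by_contra! hcon
  set M := θ (l + 2 * (b ^ 2 + 1) * (k + 1) ^ 2)
  have hbound : ∀ m ≤ M + 1, ∑ i ∈ Finset.range m, α (i + K) * β (i + K) ≤
      ((min m l : ℕ) : ℝ) + ((k : ℝ) + 1) ^ 2 * ∑ i ∈ Finset.range m,
        α (i + K) * β (i + K) * ‖x (i + K) - T (x (i + K))‖ ^ 2 := by
    intro m
    induction m with
    | zero => simp
    | succ m ih =>
      intro hm
      have ih := ih (by omega)
      have h0 : 0 ≤ α (m + K) * β (m + K) := mul_nonneg (hα _).1 (hβmem _).1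
      rw [Finset.sum_range_succ, Finset.sum_range_succ, mul_add]
      rcases lt_or_ge m l with hml | hml
      · have h1 : α (m + K) * β (m + K) ≤ 1 := mul_le_one₀ (hα _).2 (hβmem _).1 (hβmem _).2
        rw [min_eq_left hml.le] at ih
        rw [min_eq_left (Nat.succ_le_of_lt hml)]
        push_cast
        have : 0 ≤ ((k : ℝ) + 1) ^ 2 *
            (α (m + K) * β (m + K) * ‖x (m + K) - T (x (m + K))‖ ^ 2) := by positivity
        linarith
      · rw [min_eq_right hml] at ih
        rw [min_eq_right (by omega)]
        have hres := hcon m hml (by omega)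
        rw [div_lt_iff₀ (by positivity)] at hres
        have h1 := mul_le_mul_of_nonneg_left (one_le_pow₀ hres.le (n := 2)) h0
        rw [mul_pow] at h1
        linarith
  have h1 := hbound (M + 1) le_rfl
  have h2 := hsum (M + 1)
  have h3 := hθ (l + 2 * (b ^ 2 + 1) * (k + 1) ^ 2)
  have h4 : ((min (M + 1) l : ℕ) : ℝ) ≤ l := by exact_mod_cast min_le_right _ _
  push_cast at h3
  have hk : (0 : ℝ) < ((k : ℝ) + 1) ^ 2 := by positivity
  have h5 : (∑ i ∈ Finset.range (M + 1),
      α (i + K) * β (i + K) * ‖x (i + K) - T (x (i + K))‖ ^ 2) ≤ 2 * (b : ℝ) ^ 2 := by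
    linarith [sq_nonneg ‖x (M + 1 + K) - p‖]
  have h6 := mul_le_mul_of_nonneg_left h5 hk.le
  linarith
end

section
/- Let H be a real Hilbert space, C ⊆ H a nonempty convex subset, T : C → C an L-Lipschitzian pseudo-contraction (L > 0), (αₙ), (βₙ) sequences in [0,1] with αₙ ≤ βₙ for all n and lim βₙ = 0, β a rate of convergence of (βₙ), K := β(⌈1 + √(2L² + 4)⌉), and θ a rate of divergence of the series ∑ₙ α_{n+K}β_{n+K}. Let (xₙ) be the Ishikawa iteration starting at some x ∈ C. Suppose p ∈ C is a fixed point of T and b ∈ ℕ satisfies ‖x_K − p‖ ≤ b. Then for all l, k ∈ ℕ there exists N ∈ [l, K + θ(l + 2(b² + 1)(k + 1)²)] with ‖x_N − Tx_N‖ ≤ 1/(k+1); i.e., Δ̃(l,k) := K + θ(l + 2(b² + 1)(k + 1)²) is a modulus of liminf for (‖xₙ − Txₙ‖). -/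
lemma norm_sq_convex_comb {H : Type*} [NormedAddCommGroup H] [InnerProductSpace ℝ H]
    (t : ℝ) (u v q : H) :
    ‖t • u + (1 - t) • v - q‖ ^ 2 =
      t * ‖u - q‖ ^ 2 + (1 - t) * ‖v - q‖ ^ 2 - t * (1 - t) * ‖v - u‖ ^ 2 := by
  have h₁ : t • u + (1 - t) • v - q = t • (u - q) + (1 - t) • (v - q) := by module
  have h₂ : v - u = (v - q) - (u - q) := by abel
  rw [h₁, h₂, norm_add_sq_real, norm_sub_sq_real (v - q) (u - q), norm_smul, norm_smul, mul_pow, mul_pow,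
    Real.norm_eq_abs, Real.norm_eq_abs, sq_abs, sq_abs, real_inner_smul_left,
    real_inner_smul_right, real_inner_comm (v - q) (u - q)]
  ring

/-- One Ishikawa step of a Lipschitzian pseudo-contraction: the decrease of the squared distance
to a fixed point. -/
lemma ishikawa_step {H : Type*} [NormedAddCommGroup H] [InnerProductSpace ℝ H]
    {C : Set H} {T : H → H} {L : ℝ}
    (hLip : ∀ c ∈ C, ∀ d ∈ C, ‖T c - T d‖ ≤ L * ‖c - d‖)
    (hPC : ∀ c ∈ C, ∀ d ∈ C,
      ‖T c - T d‖ ^ 2 ≤ ‖c - d‖ ^ 2 + ‖(c - T c) - (d - T d)‖ ^ 2)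
    {a t : ℝ} (ha : 0 ≤ a) (hat : a ≤ t)
    {x y p : H} (hx : x ∈ C) (hy : y ∈ C) (hp : p ∈ C) (hfix : T p = p)
    (hyx : y = t • T x + (1 - t) • x) :
    ‖a • T y + (1 - a) • x - p‖ ^ 2 ≤
      ‖x - p‖ ^ 2 - a * t * (1 - 2 * t - L ^ 2 * t ^ 2) * ‖x - T x‖ ^ 2 := by
  have ht0 : 0 ≤ t := ha.trans hat
  have hTx := hPC x hx p hp
  have hTy := hPC y hy p hp
  rw [hfix, sub_self, sub_zero] at hTx hTy
  have hyp : ‖y - p‖ ^ 2 = t * ‖T x - p‖ ^ 2 + (1 - t) * ‖x - p‖ ^ 2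
      - t * (1 - t) * ‖x - T x‖ ^ 2 := by
    rw [hyx, norm_sq_convex_comb]
  have hyTy : ‖y - T y‖ ^ 2 = t * ‖T x - T y‖ ^ 2 + (1 - t) * ‖x - T y‖ ^ 2
      - t * (1 - t) * ‖x - T x‖ ^ 2 := by
    simpa only [← hyx] using norm_sq_convex_comb t (T x) x (T y)
  have hxy : ‖x - y‖ = t * ‖x - T x‖ := by
    have h : x - y = t • (x - T x) := by rw [hyx]; module
    rw [h, norm_smul, Real.norm_of_nonneg ht0]
  have hL : ‖T x - T y‖ ^ 2 ≤ L ^ 2 * t ^ 2 * ‖x - T x‖ ^ 2 := by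
    have h := pow_le_pow_left₀ (norm_nonneg _) (hLip x hx y hy) 2
    rw [hxy] at h
    linarith
  have h₁ : ‖T y - p‖ ^ 2 ≤ ‖x - p‖ ^ 2 + (1 - t) * ‖x - T y‖ ^ 2
      - t * (1 - 2 * t - L ^ 2 * t ^ 2) * ‖x - T x‖ ^ 2 := by
    linarith [mul_le_mul_of_nonneg_left hTx ht0, mul_le_mul_of_nonneg_left hL ht0]
  rw [norm_sq_convex_comb]
  have h₂ := mul_le_mul_of_nonneg_left h₁ ha
  have h₃ : 0 ≤ a * (t - a) * ‖x - T y‖ ^ 2 :=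
    mul_nonneg (mul_nonneg ha (sub_nonneg.2 hat)) (sq_nonneg _)
  linarith

lemma half_le_of_le_one_div_ceil {L t : ℝ} (ht0 : 0 ≤ t)
    (ht : t ≤ 1 / ((⌈1 + Real.sqrt (2 * L ^ 2 + 4)⌉₊ : ℝ) + 1)) :
    1 / 2 ≤ 1 - 2 * t - L ^ 2 * t ^ 2 := by
  have hs : Real.sqrt (2 * L ^ 2 + 4) ^ 2 = 2 * L ^ 2 + 4 := Real.sq_sqrt (by positivity)
  have hs0 : 0 ≤ Real.sqrt (2 * L ^ 2 + 4) := Real.sqrt_nonneg _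
  have hc := Nat.le_ceil (1 + Real.sqrt (2 * L ^ 2 + 4))
  set s := Real.sqrt (2 * L ^ 2 + 4)
  have h₁ : t * (s + 2) ≤ 1 := by
    rw [le_div_iff₀ (by positivity)] at ht
    exact (mul_le_mul_of_nonneg_left (by linarith) ht0).trans ht
  have h₂ : (t * (s + 2)) ^ 2 ≤ 1 := pow_le_one₀ (by positivity) h₁
  have h₃ : L ^ 2 * t ^ 2 = t ^ 2 * (s ^ 2 - 4) / 2 := by rw [hs]; ring
  rw [h₃]
  nlinarith [mul_le_mul_of_nonneg_left h₁ ht0]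

lemma sum_ite_lt_le (l M : ℕ) :
    ∑ i ∈ Finset.range M, (if i < l then (1 : ℝ) else 0) ≤ l := by
  rw [← Finset.sum_filter, Finset.sum_const, nsmul_eq_mul, mul_one]
  have h : (Finset.range M).filter (· < l) ⊆ Finset.range l := fun i hi =>
    Finset.mem_range.2 (Finset.mem_filter.1 hi).2
  exact_mod_cast (Finset.card_le_card h).trans_eq (Finset.card_range l)

/-- `Δ̃(l,k) := K + θ(l + 2(b² + 1)(k + 1)²)` is a modulus of liminf for
`(‖xₙ − Txₙ‖)`. -/
theorem ishikawa_modulus_liminf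
    {H : Type*} [NormedAddCommGroup H] [InnerProductSpace ℝ H]
    (C : Set H) (hCne : C.Nonempty) (hCconv : Convex ℝ C)
    (T : H → H) (hTmap : ∀ c ∈ C, T c ∈ C)
    (L : ℝ) (hL : 0 < L)
    (hLip : ∀ c ∈ C, ∀ d ∈ C, ‖T c - T d‖ ≤ L * ‖c - d‖)
    (hPC : ∀ c ∈ C, ∀ d ∈ C,
      ‖T c - T d‖ ^ 2 ≤ ‖c - d‖ ^ 2 + ‖(c - T c) - (d - T d)‖ ^ 2)
    (α β : ℕ → ℝ)
    (hα : ∀ n, α n ∈ Set.Icc (0 : ℝ) 1) (hβmem : ∀ n, β n ∈ Set.Icc (0 : ℝ) 1)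
    (hA3 : ∀ n, α n ≤ β n)
    (hβ0 : Filter.Tendsto β Filter.atTop (nhds 0))
    (ρ : ℕ → ℕ) (hρ : ∀ k : ℕ, ∀ n : ℕ, ρ k ≤ n → β n ≤ 1 / ((k : ℝ) + 1))
    (K : ℕ) (hK : K = ρ ⌈1 + Real.sqrt (2 * L ^ 2 + 4)⌉₊)
    (θ : ℕ → ℕ)
    (hθ : ∀ n : ℕ, (n : ℝ) ≤ ∑ i ∈ Finset.range (θ n + 1), α (i + K) * β (i + K))
    (x₀ : H) (hx₀ : x₀ ∈ C)
    (x y : ℕ → H) (hx0 : x 0 = x₀)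
    (hy : ∀ n, y n = β n • T (x n) + (1 - β n) • x n)
    (hxs : ∀ n, x (n + 1) = α n • T (y n) + (1 - α n) • x n)
    (p : H) (hp : p ∈ C) (hfix : T p = p)
    (b : ℕ) (hb : ‖x K - p‖ ≤ (b : ℝ)) :
    ∀ l k : ℕ, ∃ N : ℕ,
      l ≤ N ∧ N ≤ K + θ (l + 2 * (b ^ 2 + 1) * (k + 1) ^ 2) ∧
      ‖x N - T (x N)‖ ≤ 1 / ((k : ℝ) + 1) := by
  have hyC : ∀ n, x n ∈ C → y n ∈ C := fun n hn => by
    rw [hy]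
    exact hCconv (hTmap _ hn) hn (hβmem n).1 (sub_nonneg.2 (hβmem n).2) (by ring)
  have hxC : ∀ n, x n ∈ C := fun n => by
    induction n with
    | zero => rwa [hx0]
    | succ n ih =>
      rw [hxs]
      exact hCconv (hTmap _ (hyC n ih)) ih (hα n).1 (sub_nonneg.2 (hα n).2) (by ring)
  have hstep : ∀ n, K ≤ n →
      ‖x (n + 1) - p‖ ^ 2 ≤ ‖x n - p‖ ^ 2 - α n * β n * ‖x n - T (x n)‖ ^ 2 / 2 := fun n hn => by
    have h₁ := ishikawa_step hLip hPC (hα n).1 (hA3 n) (hxC n) (hyC n (hxC n)) hp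
      hfix (hy n)
    rw [← hxs] at h₁
    have h₂ := half_le_of_le_one_div_ceil (hβmem n).1 (hρ _ n (hK ▸ hn))
    have h₃ : 0 ≤ α n * β n * ‖x n - T (x n)‖ ^ 2 :=
      mul_nonneg (mul_nonneg (hα n).1 (hβmem n).1) (sq_nonneg _)
    linarith [mul_le_mul_of_nonneg_left h₂ h₃]
  have hsum : ∀ M, ∑ i ∈ Finset.range M,
      α (i + K) * β (i + K) * ‖x (i + K) - T (x (i + K))‖ ^ 2 ≤
        2 * (‖x K - p‖ ^ 2 - ‖x (M + K) - p‖ ^ 2) := fun M => by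
    induction M with
    | zero => simp
    | succ M ih =>
      rw [Finset.sum_range_succ, Nat.add_right_comm M 1 K]
      linarith [hstep (M + K) (Nat.le_add_left K M)]
  intro l k
  by_contra! hcon
  set m := l + 2 * (b ^ 2 + 1) * (k + 1) ^ 2
  have hk : (0 : ℝ) < (k : ℝ) + 1 := by positivity
  have hterm : ∀ i ∈ Finset.range (θ m + 1), α (i + K) * β (i + K) ≤
      (if i < l then (1 : ℝ) else 0) +
        α (i + K) * β (i + K) * ‖x (i + K) - T (x (i + K))‖ ^ 2 * ((k : ℝ) + 1) ^ 2 := by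
    intro i hi
    have h0 : 0 ≤ α (i + K) * β (i + K) := mul_nonneg (hα _).1 (hβmem _).1
    split_ifs with hil
    · have h1 : α (i + K) * β (i + K) ≤ 1 := mul_le_one₀ (hα _).2 (hβmem _).1 (hβmem _).2
      exact h1.trans (le_add_of_nonneg_right (by positivity))
    · have hlt := hcon (i + K) (by omega) (by have := Finset.mem_range.1 hi; omega)
      rw [div_lt_iff₀ hk] at hlt
      rw [zero_add, mul_assoc, ← mul_pow]
      exact le_mul_of_one_le_right h0 (one_le_pow₀ hlt.le)
  have hle := (hθ m).trans (Finset.sum_le_sum hterm)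
  rw [Finset.sum_add_distrib, ← Finset.sum_mul] at hle
  have hb2 : ‖x K - p‖ ^ 2 ≤ (b : ℝ) ^ 2 := pow_le_pow_left₀ (norm_nonneg _) hb 2
  have hS := (hsum (θ m + 1)).trans (b := 2 * (‖x K - p‖ ^ 2 - _)) (c := 2 * (b : ℝ) ^ 2)
    (by linarith [sq_nonneg ‖x (θ m + 1 + K) - p‖])
  have hm : (m : ℝ) = l + 2 * ((b : ℝ) ^ 2 + 1) * ((k : ℝ) + 1) ^ 2 := by
    simp only [m]; push_cast; ring
  have hk2 : (0 : ℝ) < ((k : ℝ) + 1) ^ 2 := by positivity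
  linarith [sum_ite_lt_le l (θ m + 1), mul_le_mul_of_nonneg_right hS hk2.le]
end

section
/- Let H be a real Hilbert space, C ⊆ H a nonempty convex subset, and T : C → C an L-Lipschitzian pseudo-contraction (L > 0). Let (xₙ) be the Ishikawa iteration starting at some x ∈ C with weights αₙ = βₙ = 1/√(n+1), and set K₀ := (⌈1 + √(2L² + 4)⌉ + 1)². Suppose p ∈ C is a fixed point of T and b ∈ ℕ satisfies ‖x_{K₀} − p‖ ≤ b. Then for all l, k ∈ ℕ there exists N with l ≤ N ≤ 4^{l + K₀ + 2(b² + 1)(k + 1)²} such that ‖x_N − Tx_N‖ ≤ 1/(k+1); i.e., Γ(l,k) := 4^{l + K₀ + 2(b² + 1)(k + 1)²} is a modulus of liminf for (‖xₙ − Txₙ‖). -/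
theorem norm_sq_smul_add_one_sub_smul {H : Type*} [NormedAddCommGroup H]
    [InnerProductSpace ℝ H] (t : ℝ) (a b : H) :
    ‖t • a + (1 - t) • b‖ ^ 2 =
      t * ‖a‖ ^ 2 + (1 - t) * ‖b‖ ^ 2 - t * (1 - t) * ‖a - b‖ ^ 2 := by
  rw [norm_add_sq_real, norm_sub_sq_real, norm_smul, norm_smul, real_inner_smul_left,
    real_inner_smul_right, mul_pow, mul_pow, Real.norm_eq_abs, Real.norm_eq_abs, sq_abs, sq_abs]
  ring

/-- The distance to a fixed point after one Ishikawa step with both weights equal to `t`. -/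
theorem ishikawa_step_norm_sq_le_s13 {H : Type*} [NormedAddCommGroup H] [InnerProductSpace ℝ H]
    {C : Set H} {T : H → H} {L : ℝ}
    (hLip : ∀ c ∈ C, ∀ d ∈ C, ‖T c - T d‖ ≤ L * ‖c - d‖)
    (hPC : ∀ c ∈ C, ∀ d ∈ C,
      ‖T c - T d‖ ^ 2 ≤ ‖c - d‖ ^ 2 + ‖(c - T c) - (d - T d)‖ ^ 2)
    {p u v : H} (hp : p ∈ C) (hfix : T p = p) (hu : u ∈ C) (hv : v ∈ C)
    {t : ℝ} (ht0 : 0 ≤ t) (hvu : v = t • T u + (1 - t) • u) :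
    ‖t • T v + (1 - t) • u - p‖ ^ 2 ≤
      ‖u - p‖ ^ 2 - t ^ 2 * (1 - 2 * t - L ^ 2 * t ^ 2) * ‖u - T u‖ ^ 2 := by
  have hstep := norm_sq_smul_add_one_sub_smul t (T v - p) (u - p)
  rw [show t • (T v - p) + (1 - t) • (u - p) = t • T v + (1 - t) • u - p by module,
    sub_sub_sub_cancel_right] at hstep
  have hvp := norm_sq_smul_add_one_sub_smul t (T u - p) (u - p)
  rw [show t • (T u - p) + (1 - t) • (u - p) = v - p by rw [hvu]; module,
    sub_sub_sub_cancel_right, norm_sub_rev (T u) u] at hvp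
  have hvT := norm_sq_smul_add_one_sub_smul t (T u - T v) (u - T v)
  rw [show t • (T u - T v) + (1 - t) • (u - T v) = v - T v by nth_rw 3 [hvu]; module,
    sub_sub_sub_cancel_right, norm_sub_rev (T u) u] at hvT
  have hPCv := hPC v hv p hp
  have hPCu := hPC u hu p hp
  rw [hfix, sub_self, sub_zero] at hPCv hPCu
  have hdist : ‖u - v‖ = t * ‖u - T u‖ := by
    rw [show u - v = t • (u - T u) by rw [hvu]; module, norm_smul, Real.norm_of_nonneg ht0]
  have hLuv : ‖T u - T v‖ ^ 2 ≤ L ^ 2 * t ^ 2 * ‖u - T u‖ ^ 2 := by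
    have h := pow_le_pow_left₀ (norm_nonneg _) (hLip u hu v hv) 2
    rw [hdist] at h
    linarith
  rw [norm_sub_rev (T v) u] at hstep
  have h1 := mul_le_mul_of_nonneg_left hPCv ht0
  have h2 := mul_le_mul_of_nonneg_left hPCu (sq_nonneg t)
  have h3 := mul_le_mul_of_nonneg_left hLuv (sq_nonneg t)
  rw [hvp, hvT] at h1
  rw [hstep]
  linarith

theorem half_le_one_sub_two_mul_inv_sub {L s : ℝ} (hs : 2 + √(2 * L ^ 2 + 4) ≤ s) :
    1 / 2 ≤ 1 - 2 * (1 / s) - L ^ 2 * (1 / s) ^ 2 := by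
  have hr := Real.sqrt_nonneg (2 * L ^ 2 + 4)
  have hr2 := Real.sq_sqrt (show (0 : ℝ) ≤ 2 * L ^ 2 + 4 by positivity)
  have hs0 : 0 < s := by linarith
  have hq : 0 ≤ s ^ 2 - 4 * s - 2 * L ^ 2 := by nlinarith
  have h : 1 - 2 * (1 / s) - L ^ 2 * (1 / s) ^ 2 - 1 / 2 =
      (s ^ 2 - 4 * s - 2 * L ^ 2) / (2 * s ^ 2) := by
    field_simp
    ring
  have : 0 ≤ (s ^ 2 - 4 * s - 2 * L ^ 2) / (2 * s ^ 2) := by positivity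
  linarith

theorem log_natCast_add_two_le (n : ℕ) :
    Real.log ((n : ℝ) + 2) ≤ Real.log ((n : ℝ) + 1) + 1 / ((n : ℝ) + 1) := by
  have hn : (0 : ℝ) < (n : ℝ) + 1 := by positivity
  have h := Real.log_le_sub_one_of_pos
    (show (0 : ℝ) < ((n : ℝ) + 2) / ((n : ℝ) + 1) by positivity)
  rw [Real.log_div (by positivity) hn.ne'] at h
  have : ((n : ℝ) + 2) / ((n : ℝ) + 1) - 1 = 1 / ((n : ℝ) + 1) := by
    field_simp
    ring
  linarith

/-- A sequence `a` decreasing by at least `d n / (2 (n + 1))` at each step, with `d` bounded below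
by `c`, decreases logarithmically. -/
theorem add_log_le_of_step_le {a d : ℕ → ℝ} {c : ℝ} {m M : ℕ} (hmM : m ≤ M) (hc : 0 ≤ c)
    (hstep : ∀ n, m ≤ n → a (n + 1) ≤ a n - d n / (2 * ((n : ℝ) + 1)))
    (hd : ∀ n, m ≤ n → n < M → c ≤ d n) :
    a M + c / 2 * Real.log ((M : ℝ) + 1) ≤ a m + c / 2 * Real.log ((m : ℝ) + 1) := by
  induction M, hmM using Nat.le_induction with
  | base => exact le_rfl
  | succ n hmn ih =>
    have ih := ih fun j hj hjn => hd j hj (hjn.trans n.lt_succ_self)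
    have hlog := mul_le_mul_of_nonneg_left (log_natCast_add_two_le n) (div_nonneg hc zero_le_two)
    have hdn : c / (2 * ((n : ℝ) + 1)) ≤ d n / (2 * ((n : ℝ) + 1)) := by
      gcongr
      exact hd n hmn n.lt_succ_self
    have hcn : c / 2 * (1 / ((n : ℝ) + 1)) = c / (2 * ((n : ℝ) + 1)) := by
      field_simp
    have hs := hstep n hmn
    push_cast
    rw [show (n : ℝ) + 1 + 1 = (n : ℝ) + 2 by ring]
    linarith

/-- If `a` is nonnegative and bounded by `b²` at `K`, its decrements force `d` to be small at some
index between `l` and `4 ^ (l + K + 2 (b² + 1) (k + 1)²)`. -/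
theorem exists_le_inv_sq_of_step_le {a d : ℕ → ℝ} {K b : ℕ} (ha : ∀ n, 0 ≤ a n)
    (hd : ∀ n, 0 ≤ d n)
    (hstep : ∀ n, K ≤ n → a (n + 1) ≤ a n - d n / (2 * ((n : ℝ) + 1)))
    (hb : a K ≤ (b : ℝ) ^ 2) (l k : ℕ) :
    ∃ N, l ≤ N ∧ N ≤ 4 ^ (l + K + 2 * (b ^ 2 + 1) * (k + 1) ^ 2) ∧
      d N ≤ (1 / ((k : ℝ) + 1)) ^ 2 := by
  by_contra! hcon
  set E := 2 * (b ^ 2 + 1) * (k + 1) ^ 2 with hE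
  have hmM : l + K ≤ 4 ^ (l + K + E) :=
    (Nat.le_add_right _ _).trans (Nat.lt_pow_self (by norm_num)).le
  have hanti := add_log_le_of_step_le (Nat.le_add_left K l) le_rfl hstep fun n _ _ => hd n
  have hmain := add_log_le_of_step_le hmM (sq_nonneg (1 / ((k : ℝ) + 1)))
    (fun n hn => hstep n (by omega)) fun n hn hnM => (hcon n (by omega) hnM.le).le
  have hlog_m : Real.log (((l + K : ℕ) : ℝ) + 1) ≤ ((l + K : ℕ) : ℝ) := by
    have := Real.log_le_sub_one_of_pos (show (0 : ℝ) < ((l + K : ℕ) : ℝ) + 1 by positivity)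
    linarith
  have hlog_M : ((l + K + E : ℕ) : ℝ) ≤ Real.log (((4 ^ (l + K + E) : ℕ) : ℝ) + 1) := by
    rw [Real.le_log_iff_exp_le (by positivity), ← Real.exp_one_pow]
    have : Real.exp 1 ^ (l + K + E) ≤ 4 ^ (l + K + E) := by
      gcongr
      linarith [Real.exp_one_lt_d9]
    push_cast
    linarith
  have hc : (1 / ((k : ℝ) + 1)) ^ 2 / 2 * (E : ℝ) = (b : ℝ) ^ 2 + 1 := by
    rw [hE]
    push_cast
    field_simp
  have hdiff : (E : ℝ) ≤ Real.log (((4 ^ (l + K + E) : ℕ) : ℝ) + 1) -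
      Real.log (((l + K : ℕ) : ℝ) + 1) := by
    rw [Nat.cast_add (l + K) E] at hlog_M
    linarith
  have := mul_le_mul_of_nonneg_left hdiff
    (show 0 ≤ (1 / ((k : ℝ) + 1)) ^ 2 / 2 by positivity)
  linarith [ha (4 ^ (l + K + E))]

/-- exponential modulus of liminf for the Ishikawa iteration with weights
`αₙ = βₙ = 1/√(n+1)`: with `K₀ := (⌈1 + √(2L² + 4)⌉ + 1)²`,
`Γ(l,k) := 4^(l + K₀ + 2(b² + 1)(k + 1)²)` is a modulus of liminf for `(‖xₙ − Txₙ‖)`. -/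
theorem ishikawa_modulus_liminf_sqrt_weights
    {H : Type*} [NormedAddCommGroup H] [InnerProductSpace ℝ H]
    (C : Set H) (hCne : C.Nonempty) (hCconv : Convex ℝ C)
    (T : H → H) (hTmap : ∀ c ∈ C, T c ∈ C)
    (L : ℝ) (hL : 0 < L)
    (hLip : ∀ c ∈ C, ∀ d ∈ C, ‖T c - T d‖ ≤ L * ‖c - d‖)
    (hPC : ∀ c ∈ C, ∀ d ∈ C,
      ‖T c - T d‖ ^ 2 ≤ ‖c - d‖ ^ 2 + ‖(c - T c) - (d - T d)‖ ^ 2)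
    (x₀ : H) (hx₀ : x₀ ∈ C)
    (x y : ℕ → H) (hx0 : x 0 = x₀)
    (hy : ∀ n, y n = (1 / Real.sqrt ((n : ℝ) + 1)) • T (x n) +
      (1 - 1 / Real.sqrt ((n : ℝ) + 1)) • x n)
    (hxs : ∀ n, x (n + 1) = (1 / Real.sqrt ((n : ℝ) + 1)) • T (y n) +
      (1 - 1 / Real.sqrt ((n : ℝ) + 1)) • x n)
    (K₀ : ℕ) (hK₀ : K₀ = (⌈1 + Real.sqrt (2 * L ^ 2 + 4)⌉₊ + 1) ^ 2)
    (p : H) (hp : p ∈ C) (hfix : T p = p)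
    (b : ℕ) (hb : ‖x K₀ - p‖ ≤ (b : ℝ)) :
    ∀ l k : ℕ, ∃ N : ℕ,
      l ≤ N ∧ N ≤ 4 ^ (l + K₀ + 2 * (b ^ 2 + 1) * (k + 1) ^ 2) ∧
      ‖x N - T (x N)‖ ≤ 1 / ((k : ℝ) + 1) := by
  have ht (n : ℕ) : 0 ≤ 1 / √((n : ℝ) + 1) ∧ 1 / √((n : ℝ) + 1) ≤ 1 := by
    have h1 : (1 : ℝ) ≤ √((n : ℝ) + 1) := Real.one_le_sqrt.mpr (by simp)
    exact ⟨by positivity, (div_le_one (by linarith)).mpr h1⟩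
  have hconv (n : ℕ) {c d : H} (hc : c ∈ C) (hd : d ∈ C) :
      (1 / √((n : ℝ) + 1)) • c + (1 - 1 / √((n : ℝ) + 1)) • d ∈ C :=
    hCconv hc hd (ht n).1 (sub_nonneg.mpr (ht n).2) (add_sub_cancel _ _)
  have hyC {n : ℕ} (h : x n ∈ C) : y n ∈ C := hy n ▸ hconv n (hTmap _ h) h
  have hxC (n : ℕ) : x n ∈ C := by
    induction n with
    | zero => exact hx0 ▸ hx₀
    | succ n ih => exact hxs n ▸ hconv n (hTmap _ (hyC ih)) ih
  have hstep (n : ℕ) (hn : K₀ ≤ n) :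
      ‖x (n + 1) - p‖ ^ 2 ≤ ‖x n - p‖ ^ 2 - ‖x n - T (x n)‖ ^ 2 / (2 * ((n : ℝ) + 1)) := by
    have hs : 2 + √(2 * L ^ 2 + 4) ≤ √((n : ℝ) + 1) := by
      have hceil := Nat.le_ceil (1 + √(2 * L ^ 2 + 4))
      refine le_trans (by linarith) (Real.le_sqrt_of_sq_le
        (x := (⌈1 + √(2 * L ^ 2 + 4)⌉₊ : ℝ) + 1) ?_)
      have : ((K₀ : ℕ) : ℝ) ≤ n := by exact_mod_cast hn
      rw [hK₀] at this
      push_cast at this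
      linarith
    have h := ishikawa_step_norm_sq_le_s13 hLip hPC hp hfix (hxC n) (hyC (hxC n))
      (ht n).1 (hy n)
    rw [← hxs n] at h
    have hhalf := mul_le_mul_of_nonneg_left (half_le_one_sub_two_mul_inv_sub hs)
      (show 0 ≤ (1 / √((n : ℝ) + 1)) ^ 2 * ‖x n - T (x n)‖ ^ 2 by positivity)
    have hsq : (1 / √((n : ℝ) + 1)) ^ 2 * ‖x n - T (x n)‖ ^ 2 * (1 / 2) =
        ‖x n - T (x n)‖ ^ 2 / (2 * ((n : ℝ) + 1)) := by
      rw [div_pow, Real.sq_sqrt (by positivity)]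
      field_simp
    linarith
  intro l k
  obtain ⟨N, hlN, hNM, hN⟩ := exists_le_inv_sq_of_step_le (a := fun n => ‖x n - p‖ ^ 2)
    (d := fun n => ‖x n - T (x n)‖ ^ 2) (fun n => sq_nonneg _) (fun n => sq_nonneg _) hstep
    (pow_le_pow_left₀ (norm_nonneg _) hb 2) l k
  exact ⟨N, hlN, hNM, (sq_le_sq₀ (norm_nonneg _) (by positivity)).mp hN⟩
end

section
/- Let H be a real Hilbert space, C ⊆ H a nonempty convex subset, and T : C → C an L-Lipschitzian pseudo-contraction (L > 0). Then the fixed point set F := Fix(T) is uniformly closed with moduli ω_F(k) := ⌈L⌉(4k + 4) and δ_F(k) := 2k + 1; that is, for all k ∈ ℕ and all p, q ∈ C, if ‖q − Tq‖ ≤ 1/(2k + 2) and ‖p − q‖ ≤ 1/(⌈L⌉(4k + 4) + 1), then ‖p − Tp‖ ≤ 1/(k + 1). -/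
/-- the fixed point set of an `L`-Lipschitzian pseudo-contraction is
uniformly closed with moduli `ω_F(k) := ⌈L⌉(4k + 4)` and `δ_F(k) := 2k + 1`. -/
theorem fixedPointSet_uniformly_closed
    {H : Type*} [NormedAddCommGroup H] [InnerProductSpace ℝ H]
    (C : Set H) (hCne : C.Nonempty) (hCconv : Convex ℝ C)
    (T : H → H) (hTmap : ∀ c ∈ C, T c ∈ C)
    (L : ℝ) (hL : 0 < L)
    (hLip : ∀ c ∈ C, ∀ d ∈ C, ‖T c - T d‖ ≤ L * ‖c - d‖)
    (hPC : ∀ c ∈ C, ∀ d ∈ C,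
      ‖T c - T d‖ ^ 2 ≤ ‖c - d‖ ^ 2 + ‖(c - T c) - (d - T d)‖ ^ 2) :
    ∀ k : ℕ, ∀ p ∈ C, ∀ q ∈ C,
      ‖q - T q‖ ≤ 1 / (2 * (k : ℝ) + 2) →
      ‖p - q‖ ≤ 1 / ((⌈L⌉₊ * (4 * k + 4) : ℕ) + 1 : ℝ) →
      ‖p - T p‖ ≤ 1 / ((k : ℝ) + 1) := by
  intro k p hp q hq hqT hpq
  have hN : L ≤ (⌈L⌉₊ : ℝ) := Nat.le_ceil L
  have hN1 : (1 : ℝ) ≤ (⌈L⌉₊ : ℝ) := by exact_mod_cast Nat.ceil_pos.mpr hL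
  have hk : (0 : ℝ) ≤ k := k.cast_nonneg
  push_cast at hpq
  set N : ℝ := (⌈L⌉₊ : ℝ)
  have htri : ‖p - T p‖ ≤ ‖p - q‖ + ‖q - T q‖ + ‖T p - T q‖ := by
    rw [show p - T p = (p - q) + (q - T q) - (T p - T q) by abel]
    exact (norm_sub_le _ _).trans (add_le_add_left (norm_add_le _ _) _)
  have hLpq : L * ‖p - q‖ ≤ N * ‖p - q‖ := by gcongr
  have hdist : ‖p - q‖ ≤ N * ‖p - q‖ := le_mul_of_one_le_left (norm_nonneg _) hN1
  have hNpq : 2 * N * ‖p - q‖ ≤ 1 / (2 * (k : ℝ) + 2) := by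
    calc 2 * N * ‖p - q‖ ≤ 2 * N * (1 / (N * (4 * k + 4) + 1)) := by gcongr
      _ ≤ 1 / (2 * (k : ℝ) + 2) := by
        rw [mul_one_div, div_le_div_iff₀ (by positivity) (by positivity)]
        linarith
  have hhalves : 1 / (2 * (k : ℝ) + 2) + 1 / (2 * (k : ℝ) + 2) = 1 / ((k : ℝ) + 1) := by
    field_simp
    ring
  linarith [hLip p hp q hq]
end

section
/- Let H be a real Hilbert space, C ⊆ H a nonempty bounded convex subset with diameter at most b ∈ ℕ, T : C → C an L-Lipschitzian pseudo-contraction (L > 0) with Fix(T) ≠ ∅, (αₙ), (βₙ) sequences in [0,1] with αₙ ≤ βₙ for all n and lim βₙ = 0, β a rate of convergence of (βₙ), K := β(⌈1 + √(2L² + 4)⌉), (xₙ) the Ishikawa iteration starting at some x ∈ C, and zₙ := x_{n+K}. Then (zₙ) is uniformly (G,H)-Fejér monotone with respect to Fix(T) with modulus χ(n,m,r) := 8bm(r+1), where G(a) = H(a) = a²: for all n, m, r ∈ ℕ, every p ∈ C with ‖p − Tp‖ ≤ 1/(8bm(r+1) + 1), and every l ≤ m, one has ‖z_{n+l} − p‖²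 < ‖zₙ − p‖² + 1/(r+1). -/
/-- The squared distance from a convex combination to a point. -/
theorem norm_sq_convex_comb_sub {H : Type*} [NormedAddCommGroup H] [InnerProductSpace ℝ H]
    (t : ℝ) (u v p : H) :
    ‖t • u + (1 - t) • v - p‖ ^ 2 =
      t * ‖u - p‖ ^ 2 + (1 - t) * ‖v - p‖ ^ 2 - t * (1 - t) * ‖u - v‖ ^ 2 := by
  have h₁ : t • u + (1 - t) • v - p = t • (u - p) + (1 - t) • (v - p) := by module
  have h₂ : u - v = (u - p) - (v - p) := by abel
  rw [h₁, h₂, norm_add_sq_real, norm_sub_sq_real (u - p), norm_smul, norm_smul, mul_pow, mul_pow,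
    inner_smul_left, inner_smul_right, Real.norm_eq_abs, Real.norm_eq_abs, sq_abs, sq_abs]
  simp only [conj_trivial]
  ring

/-- A pseudo-contractive pair `(c, Tc)`, `(p, Tp)` yields a perturbed demicontractivity inequality
whose error is controlled by `‖p - Tp‖`. -/
theorem norm_sq_sub_le_of_pseudocontractive {H : Type*} [NormedAddCommGroup H]
    [InnerProductSpace ℝ H] {c p Tc Tp : H} {B : ℝ} (hB : ‖c - p‖ ≤ B)
    (h : ‖Tc - Tp‖ ^ 2 ≤ ‖c - p‖ ^ 2 + ‖(c - Tc) - (p - Tp)‖ ^ 2) :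
    ‖Tc - p‖ ^ 2 ≤ ‖c - p‖ ^ 2 + ‖c - Tc‖ ^ 2 + 2 * B * ‖p - Tp‖ := by
  have hin : -inner ℝ (c - p) (p - Tp) ≤ B * ‖p - Tp‖ :=
    (neg_le_abs _).trans ((abs_real_inner_le_norm _ _).trans (by gcongr))
  have h₁ : Tc - Tp = (c - p) - ((c - Tc) - (p - Tp)) := by abel
  have h₂ : Tc - p = (c - p) - (c - Tc) := by abel
  rw [h₁, norm_sub_sq_real, inner_sub_right] at h
  rw [h₂, norm_sub_sq_real]
  linarith

/-- One Ishikawa step is Fejér monotone up to an error proportional to `‖p - Tp‖`. -/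
theorem ishikawa_step_norm_sq_le_s17 {H : Type*} [NormedAddCommGroup H] [InnerProductSpace ℝ H]
    {u v p Tu Tv Tp : H} {a t L B : ℝ} (ha : 0 ≤ a) (hat : a ≤ t) (ht : t ≤ 1)
    (hsmall : 2 * t + L ^ 2 * t ^ 2 ≤ 1) (hv : v = t • Tu + (1 - t) • u)
    (huB : ‖u - p‖ ≤ B) (hvB : ‖v - p‖ ≤ B) (hLip : ‖Tu - Tv‖ ≤ L * ‖u - v‖)
    (hu : ‖Tu - Tp‖ ^ 2 ≤ ‖u - p‖ ^ 2 + ‖(u - Tu) - (p - Tp)‖ ^ 2)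
    (hv' : ‖Tv - Tp‖ ^ 2 ≤ ‖v - p‖ ^ 2 + ‖(v - Tv) - (p - Tp)‖ ^ 2) :
    ‖a • Tv + (1 - a) • u - p‖ ^ 2 ≤ ‖u - p‖ ^ 2 + 4 * B * ‖p - Tp‖ := by
  have ht0 : 0 ≤ t := ha.trans hat
  have hE : 0 ≤ B * ‖p - Tp‖ := mul_nonneg ((norm_nonneg _).trans huB) (norm_nonneg _)
  have eu := norm_sq_sub_le_of_pseudocontractive huB hu
  have ev := norm_sq_sub_le_of_pseudocontractive hvB hv'
  have evp := norm_sq_convex_comb_sub t Tu u p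
  have evT := norm_sq_convex_comb_sub t Tu u Tv
  rw [← hv] at evp evT
  have huv : ‖u - v‖ = t * ‖Tu - u‖ := by
    rw [hv, show u - (t • Tu + (1 - t) • u) = (-t) • (Tu - u) by module, norm_smul, norm_neg,
      Real.norm_of_nonneg ht0]
  have hLip2 : ‖Tu - Tv‖ ^ 2 ≤ L ^ 2 * t ^ 2 * ‖Tu - u‖ ^ 2 := by
    rw [huv] at hLip
    calc ‖Tu - Tv‖ ^ 2 ≤ (L * (t * ‖Tu - u‖)) ^ 2 := by gcongr
      _ = _ := by ring
  rw [norm_sub_rev u Tu] at eu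
  have e₁ := mul_le_mul_of_nonneg_left eu ht0
  have e₂ := mul_le_mul_of_nonneg_left hLip2 ht0
  have e₃ : 0 ≤ t * ‖Tu - u‖ ^ 2 * (1 - (2 * t + L ^ 2 * t ^ 2)) :=
    mul_nonneg (by positivity) (by linarith)
  have e₄ : t * (B * ‖p - Tp‖) ≤ B * ‖p - Tp‖ := mul_le_of_le_one_left hE ht
  have e₅ : 0 ≤ (t - a) * ‖u - Tv‖ ^ 2 := mul_nonneg (by linarith) (by positivity)
  have key : ‖Tv - p‖ ^ 2 - ‖u - p‖ ^ 2 - (1 - a) * ‖u - Tv‖ ^ 2 ≤ 4 * (B * ‖p - Tp‖) := by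
    linarith
  have e₆ := mul_le_mul_of_nonneg_left key ha
  have e₇ : a * (B * ‖p - Tp‖) ≤ B * ‖p - Tp‖ := mul_le_of_le_one_left hE (hat.trans ht)
  rw [norm_sq_convex_comb_sub, norm_sub_rev Tv u]
  linarith

/-- The step-size bound provided by the rate of convergence makes the Ishikawa step contractive. -/
theorem two_mul_add_sq_mul_sq_le_one {L t : ℝ} (ht0 : 0 ≤ t)
    (ht : t ≤ 1 / ((⌈1 + √(2 * L ^ 2 + 4)⌉₊ : ℝ) + 1)) :
    2 * t + L ^ 2 * t ^ 2 ≤ 1 := by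
  have hs2 : √(2 * L ^ 2 + 4) ^ 2 = 2 * L ^ 2 + 4 := Real.sq_sqrt (by positivity)
  have hs0 := Real.sqrt_nonneg (2 * L ^ 2 + 4)
  have hk := Nat.le_ceil (1 + √(2 * L ^ 2 + 4))
  set s := √(2 * L ^ 2 + 4)
  rw [le_div_iff₀ (by positivity)] at ht
  have h₁ : t * (2 + s) ≤ 1 := 
    (mul_le_mul_of_nonneg_left (by linarith) ht0).trans ht
  have h₂ : (t * (2 + s)) ^ 2 ≤ 1 := pow_le_one₀ (by positivity) h₁
  have h₃ : 0 ≤ t * s := by positivity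
  nlinarith [sq_nonneg t, sq_nonneg (t * s)]


/-- `(zₙ)` with `zₙ := x_{n+K}` is uniformly `(G,H)`-Fejér monotone
w.r.t. `Fix(T)` with modulus `χ(n,m,r) := 8bm(r+1)`, where `G(a) = H(a) = a²`. -/
theorem ishikawa_uniformly_fejer_monotone
    {H : Type*} [NormedAddCommGroup H] [InnerProductSpace ℝ H]
    (C : Set H) (hCne : C.Nonempty) (hCconv : Convex ℝ C)
    (b : ℕ) (hb : ∀ c ∈ C, ∀ d ∈ C, ‖c - d‖ ≤ (b : ℝ))
    (T : H → H) (hTmap : ∀ c ∈ C, T c ∈ C)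
    (L : ℝ) (hL : 0 < L)
    (hLip : ∀ c ∈ C, ∀ d ∈ C, ‖T c - T d‖ ≤ L * ‖c - d‖)
    (hPC : ∀ c ∈ C, ∀ d ∈ C,
      ‖T c - T d‖ ^ 2 ≤ ‖c - d‖ ^ 2 + ‖(c - T c) - (d - T d)‖ ^ 2)
    (hFix : ∃ q ∈ C, T q = q)
    (α β : ℕ → ℝ)
    (hα : ∀ n, α n ∈ Set.Icc (0 : ℝ) 1) (hβmem : ∀ n, β n ∈ Set.Icc (0 : ℝ) 1)
    (hA3 : ∀ n, α n ≤ β n)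
    (hβ0 : Filter.Tendsto β Filter.atTop (nhds 0))
    (ρ : ℕ → ℕ) (hρ : ∀ k : ℕ, ∀ n : ℕ, ρ k ≤ n → β n ≤ 1 / ((k : ℝ) + 1))
    (K : ℕ) (hK : K = ρ ⌈1 + Real.sqrt (2 * L ^ 2 + 4)⌉₊)
    (x₀ : H) (hx₀ : x₀ ∈ C)
    (x y : ℕ → H) (hx0 : x 0 = x₀)
    (hy : ∀ n, y n = β n • T (x n) + (1 - β n) • x n)
    (hxs : ∀ n, x (n + 1) = α n • T (y n) + (1 - α n) • x n) :
    ∀ n m r : ℕ, ∀ p ∈ C,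
      ‖p - T p‖ ≤ 1 / ((8 * b * m * (r + 1) : ℕ) + 1 : ℝ) →
      ∀ l : ℕ, l ≤ m →
        ‖x (n + l + K) - p‖ ^ 2 < ‖x (n + K) - p‖ ^ 2 + 1 / ((r : ℝ) + 1) := by
  intro n m r p hp hpT l hl
  have hstep : ∀ u ∈ C, ∀ v ∈ C, ∀ t ∈ Set.Icc (0 : ℝ) 1, t • u + (1 - t) • v ∈ C :=
    fun u hu v hv t ht => hCconv hu hv ht.1 (by linarith [ht.2]) (by ring)
  have hyx : ∀ k, x k ∈ C → y k ∈ C := fun k hk => by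
    rw [hy]
    exact hstep _ (hTmap _ hk) _ hk _ (hβmem k)
  have hxC : ∀ k, x k ∈ C := by
    intro k
    induction k with
    | zero => rwa [hx0]
    | succ k ih =>
      rw [hxs]
      exact hstep _ (hTmap _ (hyx k ih)) _ ih _ (hα k)
  have hdesc : ∀ k, K ≤ k → ‖x (k + 1) - p‖ ^ 2 ≤ ‖x k - p‖ ^ 2 + 4 * b * ‖p - T p‖ := by
    intro k hk
    have hyC := hyx k (hxC k)
    rw [hxs]
    exact ishikawa_step_norm_sq_le_s17 (hα k).1 (hA3 k) (hβmem k).2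
      (two_mul_add_sq_mul_sq_le_one (hβmem k).1 (hρ _ k (hK ▸ hk))) (hy k)
      (hb _ (hxC k) _ hp) (hb _ hyC _ hp) (hLip _ (hxC k) _ hyC)
      (hPC _ (hxC k) _ hp) (hPC _ hyC _ hp)
  have hsum : ∀ j : ℕ, ‖x (n + j + K) - p‖ ^ 2 ≤
      ‖x (n + K) - p‖ ^ 2 + j * (4 * b * ‖p - T p‖) := by
    intro j
    induction j with
    | zero => simp
    | succ j ih =>
      have h := hdesc (n + j + K) (by omega)
      rw [show n + (j + 1) + K = n + j + K + 1 by ring]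
      push_cast
      linarith
  have hlm : (l : ℝ) * (4 * b * ‖p - T p‖) ≤ m * (4 * b * ‖p - T p‖) := by gcongr
  have herr : (m : ℝ) * (4 * b * ‖p - T p‖) < 1 / ((r : ℝ) + 1) := by
    rw [le_div_iff₀ (by positivity)] at hpT
    push_cast at hpT
    rw [lt_div_iff₀ (by positivity)]
    nlinarith [norm_nonneg (p - T p)]
  linarith [hsum l]
end

section
/- Let H be a real Hilbert space, C ⊆ H a nonempty totally bounded convex subset with modulus of total boundedness γ and diameter at most b ∈ ℕ, T : C → C an L-Lipschitzian pseudo-contraction (L > 0) with Fix(T) ≠ ∅, (αₙ), (βₙ) sequences in [0,1] with αₙ ≤ βₙ for all n and lim βₙ = 0, β a rate of convergence of (βₙ), K := β(⌈1 + √(2L² + 4)⌉), and θ a rate of divergence of the series ∑ₙ α_{n+K}β_{n+K}. Let (xₙ) be the Ishikawa iteration starting at some x ∈ C. For f : ℕ → ℕ define f^M(n) := max_{0 ≤ i ≤ n} f(i). Fix k ∈ ℕ and g : ℕ → ℕ, and set h(n) := g(K + n), P := γ(⌈√(8k² + 16k + 9)⌉), and define Σ₀ : ℕ → ℕ recursively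 by Σ₀(0) := 0 and Σ₀(n+1) := θ^M(2(b² + 1)·(8b(8k² + 16k + 10)·h^M(Σ₀(n)) + 1)²). Then there exists N ≤ K + Σ₀(P) such that for all i, j ∈ [N, N + g(N)], ‖xᵢ − xⱼ‖ ≤ 1/(k+1). -/
/-- `f^M(n) := max_{0 ≤ i ≤ n} f(i)`. -/
def maxUpTo (f : ℕ → ℕ) (n : ℕ) : ℕ := (Finset.range (n + 1)).sup f

theorem le_maxUpTo (f : ℕ → ℕ) {i n : ℕ} (h : i ≤ n) : f i ≤ maxUpTo f n :=
  Finset.le_sup (f := f) (Finset.mem_range.2 (Nat.lt_succ_of_le h))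

theorem maxUpTo_mono (f : ℕ → ℕ) : Monotone (maxUpTo f) := fun _ _ h =>
  Finset.sup_mono (Finset.range_mono (Nat.succ_le_succ h))

section InnerProduct

variable {H : Type*} [NormedAddCommGroup H] [InnerProductSpace ℝ H]

theorem norm_convexComb_sub_sq (a : ℝ) (u v p : H) :
    ‖a • u + (1 - a) • v - p‖ ^ 2 =
      a * ‖u - p‖ ^ 2 + (1 - a) * ‖v - p‖ ^ 2 - a * (1 - a) * ‖u - v‖ ^ 2 := by
  have h₁ : a • u + (1 - a) • v - p = a • (u - p) + (1 - a) • (v - p) := by module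
  have h₂ : u - v = (u - p) - (v - p) := by abel
  rw [h₁, h₂, norm_add_sq_real, norm_sub_sq_real (u - p), inner_smul_left, inner_smul_right,
    norm_smul, norm_smul, mul_pow, mul_pow, Real.norm_eq_abs, Real.norm_eq_abs, sq_abs, sq_abs]
  simp only [conj_trivial]
  ring

/-- A pseudo-contraction is demicontractive up to an error controlled by `‖p - T p‖`. -/
theorem norm_map_sub_sq_le {C : Set H} {T : H → H} {b δ : ℝ}
    (hb : ∀ c ∈ C, ∀ d ∈ C, ‖c - d‖ ≤ b)
    (hPC : ∀ c ∈ C, ∀ d ∈ C,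
      ‖T c - T d‖ ^ 2 ≤ ‖c - d‖ ^ 2 + ‖(c - T c) - (d - T d)‖ ^ 2)
    {p z : H} (hp : p ∈ C) (hz : z ∈ C) (hδ : ‖p - T p‖ ≤ δ) :
    ‖T z - p‖ ^ 2 ≤ ‖z - p‖ ^ 2 + ‖z - T z‖ ^ 2 + 2 * b * δ := by
  have hpc := hPC z hz p hp
  have h₁ : T z - T p = (z - p) - ((z - T z) - (p - T p)) := by abel
  have h₂ : T z - p = (z - p) - (z - T z) := by abel
  rw [h₁, norm_sub_sq_real, inner_sub_right] at hpc
  rw [h₂, norm_sub_sq_real]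
  have h₃ : -(inner ℝ (z - p) (p - T p)) ≤ ‖z - p‖ * ‖p - T p‖ :=
    (neg_le_abs _).trans (abs_real_inner_le_norm _ _)
  have h₄ : ‖z - p‖ * ‖p - T p‖ ≤ b * δ :=
    mul_le_mul (hb z hz p hp) hδ (norm_nonneg _) ((norm_nonneg _).trans (hb z hz p hp))
  linarith

/-- One step of the Ishikawa iteration, measured from an approximate fixed point `p`. -/
theorem ishikawa_step_le {C : Set H} (hC : Convex ℝ C) {T : H → H} {b δ L : ℝ}
    (hb : ∀ c ∈ C, ∀ d ∈ C, ‖c - d‖ ≤ b) (hT : ∀ c ∈ C, T c ∈ C)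
    (hLip : ∀ c ∈ C, ∀ d ∈ C, ‖T c - T d‖ ≤ L * ‖c - d‖)
    (hPC : ∀ c ∈ C, ∀ d ∈ C,
      ‖T c - T d‖ ^ 2 ≤ ‖c - d‖ ^ 2 + ‖(c - T c) - (d - T d)‖ ^ 2)
    {a β : ℝ} (ha : 0 ≤ a) (hβ : β ∈ Set.Icc (0 : ℝ) 1) (haβ : a ≤ β)
    {p x y : H} (hp : p ∈ C) (hx : x ∈ C) (hδ : ‖p - T p‖ ≤ δ)
    (hy : y = β • T x + (1 - β) • x) :
    ‖a • T y + (1 - a) • x - p‖ ^ 2 + a * β * (1 - 2 * β - L ^ 2 * β ^ 2) * ‖x - T x‖ ^ 2 ≤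
      ‖x - p‖ ^ 2 + 4 * b * δ := by
  obtain ⟨hβ0, hβ1⟩ := hβ
  have hyC : y ∈ C := hy ▸ hC (hT x hx) hx hβ0 (by linarith) (by ring)
  have hTx := norm_map_sub_sq_le hb hPC hp hx hδ
  have hTy := norm_map_sub_sq_le hb hPC hp hyC hδ
  have hyp := norm_convexComb_sub_sq β (T x) x p
  have hyTy := norm_convexComb_sub_sq β (T x) x (T y)
  rw [← hy, norm_sub_rev (T x) x] at hyp hyTy
  have hxy : ‖x - y‖ = β * ‖x - T x‖ := by
    rw [show x - y = β • (x - T x) by rw [hy]; module, norm_smul, Real.norm_of_nonneg hβ0]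
  have hLxy : ‖T x - T y‖ ^ 2 ≤ L ^ 2 * β ^ 2 * ‖x - T x‖ ^ 2 :=
    calc ‖T x - T y‖ ^ 2 ≤ (L * ‖x - y‖) ^ 2 :=
          pow_le_pow_left₀ (norm_nonneg _) (hLip x hx y hyC) 2
      _ = L ^ 2 * β ^ 2 * ‖x - T x‖ ^ 2 := by rw [hxy]; ring
  have hbδ : 0 ≤ b * δ := mul_nonneg ((norm_nonneg _).trans (hb x hx x hx))
    ((norm_nonneg _).trans hδ)
  have hTyp : ‖T y - p‖ ^ 2 ≤ ‖x - p‖ ^ 2 + 4 * (b * δ)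
      - β * (1 - 2 * β - L ^ 2 * β ^ 2) * ‖x - T x‖ ^ 2 + (1 - β) * ‖x - T y‖ ^ 2 := by
    linarith [mul_le_mul_of_nonneg_left hTx hβ0, mul_le_mul_of_nonneg_left hLxy hβ0,
      mul_nonneg (sub_nonneg.2 hβ1) hbδ]
  rw [norm_convexComb_sub_sq, norm_sub_rev (T y) x]
  linarith [mul_le_mul_of_nonneg_left hTyp ha,
    mul_nonneg (mul_nonneg ha (sub_nonneg.2 haβ)) (sq_nonneg ‖x - T y‖),
    mul_nonneg (sub_nonneg.2 (haβ.trans hβ1)) hbδ]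

end InnerProduct

theorem half_le_one_sub_of_le_s18 {L β : ℝ} {m : ℕ} (hβ0 : 0 ≤ β)
    (hm : 1 + √(2 * L ^ 2 + 4) ≤ m) (hβ : β ≤ 1 / ((m : ℝ) + 1)) :
    1 / 2 ≤ 1 - 2 * β - L ^ 2 * β ^ 2 := by
  have hs := Real.sqrt_nonneg (2 * L ^ 2 + 4)
  have hs2 := Real.sq_sqrt (show 0 ≤ 2 * L ^ 2 + 4 by positivity)
  set s := √(2 * L ^ 2 + 4)
  rw [le_div_iff₀ (by positivity)] at hβ
  have h : β * s ≤ 1 - 2 * β := by nlinarith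
  nlinarith [mul_nonneg hβ0 hs, pow_le_pow_left₀ (mul_nonneg hβ0 hs) h 2]

/-- If a nonnegative sequence drops by `w n * r n / 2` at each step and `∑ w` is large,
then some `r n` is small. -/
theorem exists_le_of_sum_weights {d w r : ℕ → ℝ} {B ε : ℝ} {m : ℕ} (hd : ∀ n, 0 ≤ d n)
    (hB : d 0 ≤ B) (hw : ∀ n, 0 ≤ w n) (hstep : ∀ n, d (n + 1) + w n * (r n / 2) ≤ d n)
    (hsum : 2 * B < (∑ i ∈ Finset.range (m + 1), w i) * ε) :
    ∃ n ≤ m, r n ≤ ε := by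
  by_contra! hcon
  have key : ∀ n ≤ m + 1, d n + (∑ i ∈ Finset.range n, w i) * (ε / 2) ≤ d 0 := by
    intro n
    induction n with
    | zero => simp
    | succ n ih =>
      intro hn
      have h := mul_le_mul_of_nonneg_left (hcon n (by omega)).le (hw n)
      rw [Finset.sum_range_succ]
      linarith [ih (by omega), hstep n]
  linarith [key (m + 1) le_rfl, hd (m + 1)]

/-- rate of metastability for the Ishikawa iteration of an
`L`-Lipschitzian pseudo-contraction on a totally bounded convex subset. -/
theorem ishikawa_rate_of_metastability
    {H : Type*} [NormedAddCommGroup H] [InnerProductSpace ℝ H]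
    (C : Set H) (hCne : C.Nonempty) (hCconv : Convex ℝ C)
    (γ : ℕ → ℕ)
    (hγ : ∀ k : ℕ, ∀ u : ℕ → H, (∀ n, u n ∈ C) →
      ∃ i j : ℕ, i < j ∧ j ≤ γ k ∧ ‖u i - u j‖ ≤ 1 / ((k : ℝ) + 1))
    (b : ℕ) (hb : ∀ c ∈ C, ∀ d ∈ C, ‖c - d‖ ≤ (b : ℝ))
    (T : H → H) (hTmap : ∀ c ∈ C, T c ∈ C)
    (L : ℝ) (hL : 0 < L)
    (hLip : ∀ c ∈ C, ∀ d ∈ C, ‖T c - T d‖ ≤ L * ‖c - d‖)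
    (hPC : ∀ c ∈ C, ∀ d ∈ C,
      ‖T c - T d‖ ^ 2 ≤ ‖c - d‖ ^ 2 + ‖(c - T c) - (d - T d)‖ ^ 2)
    (hFix : ∃ q ∈ C, T q = q)
    (α β : ℕ → ℝ)
    (hα : ∀ n, α n ∈ Set.Icc (0 : ℝ) 1) (hβmem : ∀ n, β n ∈ Set.Icc (0 : ℝ) 1)
    (hA3 : ∀ n, α n ≤ β n)
    (hβ0 : Filter.Tendsto β Filter.atTop (nhds 0))
    (ρ : ℕ → ℕ) (hρ : ∀ k : ℕ, ∀ n : ℕ, ρ k ≤ n → β n ≤ 1 / ((k : ℝ) + 1))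
    (K : ℕ) (hK : K = ρ ⌈1 + Real.sqrt (2 * L ^ 2 + 4)⌉₊)
    (θ : ℕ → ℕ)
    (hθ : ∀ n : ℕ, (n : ℝ) ≤ ∑ i ∈ Finset.range (θ n + 1), α (i + K) * β (i + K))
    (x₀ : H) (hx₀ : x₀ ∈ C)
    (x y : ℕ → H) (hx0 : x 0 = x₀)
    (hy : ∀ n, y n = β n • T (x n) + (1 - β n) • x n)
    (hxs : ∀ n, x (n + 1) = α n • T (y n) + (1 - α n) • x n)
    (k : ℕ) (g : ℕ → ℕ)
    (P : ℕ) (hP : P = γ ⌈Real.sqrt (8 * (k : ℝ) ^ 2 + 16 * k + 9)⌉₊)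
    (S₀ : ℕ → ℕ) (hS₀z : S₀ 0 = 0)
    (hS₀s : ∀ n : ℕ, S₀ (n + 1) =
      maxUpTo θ (2 * (b ^ 2 + 1) *
        (8 * b * (8 * k ^ 2 + 16 * k + 10) *
          maxUpTo (fun m => g (K + m)) (S₀ n) + 1) ^ 2)) :
    ∃ N : ℕ, N ≤ K + S₀ P ∧
      ∀ i j : ℕ, N ≤ i → i ≤ N + g N → N ≤ j → j ≤ N + g N →
        ‖x i - x j‖ ≤ 1 / ((k : ℝ) + 1) := by
  have hxC : ∀ n, x n ∈ C := by
    intro n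
    induction n with
    | zero => exact hx0 ▸ hx₀
    | succ n ih =>
      have hyC : y n ∈ C :=
        hy n ▸ hCconv (hTmap _ ih) ih (hβmem n).1 (sub_nonneg.2 (hβmem n).2) (by ring)
      exact hxs n ▸ hCconv (hTmap _ hyC) ih (hα n).1 (sub_nonneg.2 (hα n).2) (by ring)
  have hhalf : ∀ n, K ≤ n → 1 / 2 ≤ 1 - 2 * β n - L ^ 2 * β n ^ 2 := fun n hn =>
    half_le_one_sub_of_le_s18 (hβmem n).1 (Nat.le_ceil _) (hρ _ n (hK ▸ hn))
  have hstep : ∀ p ∈ C, ∀ δ, ‖p - T p‖ ≤ δ → ∀ n, K ≤ n →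
      ‖x (n + 1) - p‖ ^ 2 + α n * β n * (‖x n - T (x n)‖ ^ 2 / 2) ≤
        ‖x n - p‖ ^ 2 + 4 * b * δ := by
    intro p hp δ hδ n hn
    have h := ishikawa_step_le hCconv hb hTmap hLip hPC (hα n).1 (hβmem n) (hA3 n) hp (hxC n)
      hδ (hy n)
    rw [← hxs n] at h
    have h₀ : 0 ≤ α n * β n * ‖x n - T (x n)‖ ^ 2 :=
      mul_nonneg (mul_nonneg (hα n).1 (hβmem n).1) (sq_nonneg _)
    linarith [mul_le_mul_of_nonneg_left (hhalf n hn) h₀]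
  -- approximate fixed points along the orbit
  have happrox : ∀ M : ℕ, ∃ n ≤ maxUpTo θ (2 * (b ^ 2 + 1) * (M + 1) ^ 2),
      ‖x (K + n) - T (x (K + n))‖ ≤ 1 / ((M : ℝ) + 1) := by
    intro M
    obtain ⟨q, hq, hTq⟩ := hFix
    obtain ⟨n, hn, hr⟩ := exists_le_of_sum_weights
      (d := fun n => ‖x (n + K) - q‖ ^ 2) (w := fun n => α (n + K) * β (n + K))
      (r := fun n => ‖x (n + K) - T (x (n + K))‖ ^ 2) (B := (b : ℝ) ^ 2)
      (ε := (1 / ((M : ℝ) + 1)) ^ 2) (m := θ (2 * (b ^ 2 + 1) * (M + 1) ^ 2))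
      (fun _ => sq_nonneg _) (pow_le_pow_left₀ (norm_nonneg _) (hb _ (hxC _) _ hq) 2)
      (fun n => mul_nonneg (hα _).1 (hβmem _).1)
      (fun n => by
        have h := hstep q hq 0 (by simp [hTq]) (n + K) (Nat.le_add_left _ _)
        rw [show n + 1 + K = n + K + 1 by ring]
        linarith)
      (by
        have h := mul_le_mul_of_nonneg_right (hθ (2 * (b ^ 2 + 1) * (M + 1) ^ 2))
          (sq_nonneg (1 / ((M : ℝ) + 1)))
        refine lt_of_lt_of_le ?_ h
        push_cast
        rw [mul_assoc, ← mul_pow, mul_one_div_cancel (by positivity)]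
        linarith)
    refine ⟨n, hn.trans (le_maxUpTo θ le_rfl), ?_⟩
    rw [add_comm K n]
    exact le_of_sq_le_sq hr (by positivity)
  have hFejer : ∀ p ∈ C, ∀ δ, ‖p - T p‖ ≤ δ → ∀ N, K ≤ N → ∀ l : ℕ,
      ‖x (N + l) - p‖ ^ 2 ≤ ‖x N - p‖ ^ 2 + l * (4 * b * δ) := by
    intro p hp δ hδ N hN l
    induction l with
    | zero => simp
    | succ l ih =>
      have h := hstep p hp δ hδ (N + l) (by omega)
      have h₀ : 0 ≤ α (N + l) * β (N + l) * (‖x (N + l) - T (x (N + l))‖ ^ 2 / 2) :=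
        mul_nonneg (mul_nonneg (hα _).1 (hβmem _).1) (by positivity)
      push_cast
      rw [← add_assoc]
      linarith
  have hmono : Monotone S₀ := by
    refine monotone_nat_of_le_succ fun n => ?_
    induction n with
    | zero => simp [hS₀z]
    | succ n ih =>
      rw [hS₀s n, hS₀s (n + 1)]
      refine maxUpTo_mono θ ?_
      have := maxUpTo_mono (fun m => g (K + m)) ih
      gcongr
  choose ν hν hνT using happrox
  let σ : ℕ → ℕ := fun i => Nat.casesOn i 0 fun i =>
    ν (8 * b * (8 * k ^ 2 + 16 * k + 10) * maxUpTo (fun m => g (K + m)) (S₀ i))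
  have hσ : ∀ i, σ i ≤ S₀ i := by
    rintro (_ | i)
    · exact Nat.zero_le _
    · rw [hS₀s]; exact hν _
  obtain ⟨i, j, hij, hjP, hdist⟩ := hγ ⌈√(8 * (k : ℝ) ^ 2 + 16 * k + 9)⌉₊
    (fun i => x (K + σ i)) (fun i => hxC _)
  rw [← hP] at hjP
  obtain ⟨j, rfl⟩ : ∃ j', j = j' + 1 := ⟨j - 1, by omega⟩
  set G := maxUpTo (fun m => g (K + m)) (S₀ j) with hG
  have hgG : g (K + σ i) ≤ G :=
    le_maxUpTo (fun m => g (K + m)) ((hσ i).trans (hmono (by omega)))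
  have hpT := hνT (8 * b * (8 * k ^ 2 + 16 * k + 10) * G)
  set p := x (K + σ (j + 1)) with hp
  change ‖p - T p‖ ≤ _ at hpT
  have hclose : ‖x (K + σ i) - p‖ ^ 2 ≤ 1 / (8 * (k : ℝ) ^ 2 + 16 * k + 10) := by
    refine (pow_le_pow_left₀ (norm_nonneg _) hdist 2).trans ?_
    rw [div_pow, one_pow]
    refine one_div_le_one_div_of_le (by positivity) ?_
    have h₁ := Nat.le_ceil (√(8 * (k : ℝ) ^ 2 + 16 * k + 9))
    have h₂ := Real.sqrt_nonneg (8 * (k : ℝ) ^ 2 + 16 * k + 9)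
    have h₃ := Real.sq_sqrt (show 0 ≤ 8 * (k : ℝ) ^ 2 + 16 * k + 9 by positivity)
    nlinarith
  have hnear : ∀ l ≤ g (K + σ i), ‖x (K + σ i + l) - p‖ ≤ 1 / (2 * ((k : ℝ) + 1)) := by
    intro l hl
    have h := hFejer p (hxC _) _ hpT (K + σ i) (Nat.le_add_right _ _) l
    have hlG : (l : ℝ) ≤ G := by exact_mod_cast hl.trans hgG
    push_cast at h
    have herr : (l : ℝ) * (4 * b * (1 / (8 * b * (8 * k ^ 2 + 16 * k + 10) * G + 1))) ≤
        1 / (8 * (k : ℝ) ^ 2 + 16 * k + 10) := by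
      rw [mul_one_div, mul_div_assoc', div_le_div_iff₀ (by positivity) (by positivity)]
      have h₁ : (l : ℝ) * (b * (8 * (k : ℝ) ^ 2 + 16 * k + 10)) ≤
          G * (b * (8 * (k : ℝ) ^ 2 + 16 * k + 10)) :=
        mul_le_mul_of_nonneg_right hlG (by positivity)
      have h₂ : 0 ≤ (G : ℝ) * (b * (8 * (k : ℝ) ^ 2 + 16 * k + 10)) := by positivity
      linarith
    refine le_of_sq_le_sq ?_ (by positivity)
    have hfin : 2 * (1 / (8 * (k : ℝ) ^ 2 + 16 * k + 10)) ≤ (1 / (2 * ((k : ℝ) + 1))) ^ 2 := by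
      rw [div_pow, mul_one_div, div_le_div_iff₀ (by positivity) (by positivity)]
      linarith
    linarith
  refine ⟨K + σ i, Nat.add_le_add_left ((hσ i).trans (hmono (by omega))) _, ?_⟩
  intro r s hr hr' hs hs'
  obtain ⟨l, rfl⟩ := Nat.exists_eq_add_of_le hr
  obtain ⟨l', rfl⟩ := Nat.exists_eq_add_of_le hs
  calc ‖x (K + σ i + l) - x (K + σ i + l')‖
      ≤ ‖x (K + σ i + l) - p‖ + ‖x (K + σ i + l') - p‖ := by
        rw [← sub_sub_sub_cancel_right _ _ p]; exact norm_sub_le _ _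
    _ ≤ 1 / (2 * ((k : ℝ) + 1)) + 1 / (2 * ((k : ℝ) + 1)) :=
        add_le_add (hnear l (by omega)) (hnear l' (by omega))
    _ = 1 / ((k : ℝ) + 1) := by field_simp; norm_num
end
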